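/- Partition Theorem. There exists a constant K > 0 such that the following holds for every configuration as in the context, every finite set P of n points contained in C', and every integer s' with 2 ≤ s' < n. There exist a partition of P into pairwise disjoint parts P₁, …, P_m and (possibly overlapping) pseudo-trapezoids σ₁, …, σ_m in T such that for each i one has P_i ⊆ σ_i and s' ≤ |P_i| < 2s', and for every point q ∈ C the unit circle centered at q crosses at most K·√(n/s') of the pseudo-trapezoids σ₁, …, σ_m. -/

import Mathlib

open scoped Classical

noncomputable section

/-- The Euclidean plane. -/
abbrev Plane := EuclideanSpace ℝ (Fin 2)

/-- The side length `1/√2` of the grid cells. -/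
def gs : ℝ := 1 / Real.sqrt 2

/-- The closed axis-parallel square with lower-left corner `(x, y)` and side
length `gs = 1/√2`. -/
def Square (x y : ℝ) : Set Plane :=
  {z : Plane | x ≤ z 0 ∧ z 0 ≤ x + gs ∧ y ≤ z 1 ∧ z 1 ≤ y + gs}

/-- The extended cell `T` of the square `C' = [x₀, x₀+gs] × [y₀, y₀+gs]`:
the square with its top edge replaced by the upper arc of the unit circle
through the two top vertices of `C'` whose center lies below that edge. -/
def ExtCell (x₀ y₀ : ℝ) : Set Plane :=
  {z : Plane | x₀ ≤ z 0 ∧ z 0 ≤ x₀ + gs ∧ y₀ ≤ z 1 ∧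
    z 1 ≤ (y₀ + gs - Real.sqrt (7 / 8)) + Real.sqrt (1 - (z 0 - x₀ - gs / 2) ^ 2)}

/-- The upper arc of a point `q`: the part of the unit circle centered at `q`
inside the extended cell. -/
def UpperArc (x₀ y₀ : ℝ) (q : Plane) : Set Plane :=
  {z : Plane | dist z q = 1} ∩ ExtCell x₀ y₀

/-- A pseudo-trapezoid in the extended cell of `C'`: the set of points of the
extended cell with `u ≤ x ≤ v` lying between the graphs of `g₁` and `g₂`, where
`g₂` is an upper unit-circle arc centered on or below `y = y₀`, and `g₁` is
either the constant `y₀` or such an arc, with `g₁ ≤ g₂` on `[u, v]`. -/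
def IsPseudoTrapezoid (x₀ y₀ : ℝ) (σ : Set Plane) : Prop :=
  ∃ (u v : ℝ) (g₁ g₂ : ℝ → ℝ),
    u ≤ v ∧
    (∃ q₂ : Plane, q₂ 1 ≤ y₀ ∧
      ∀ x, g₂ x = q₂ 1 + Real.sqrt (1 - (x - q₂ 0) ^ 2)) ∧
    ((∀ x, g₁ x = y₀) ∨
      (∃ q₁ : Plane, q₁ 1 ≤ y₀ ∧
        ∀ x, g₁ x = q₁ 1 + Real.sqrt (1 - (x - q₁ 0) ^ 2))) ∧
    (∀ x, u ≤ x → x ≤ v → g₁ x ≤ g₂ x) ∧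
    σ = {z ∈ ExtCell x₀ y₀ | u ≤ z 0 ∧ z 0 ≤ v ∧ g₁ (z 0) ≤ z 1 ∧ z 1 ≤ g₂ (z 0)}

/-- The unit circle centered at `q` crosses `σ` if it meets the interior of `σ`. -/
def Crosses (q : Plane) (σ : Set Plane) : Prop :=
  ({z : Plane | dist z q = 1} ∩ interior σ).Nonempty

/-- The number of members of the collection `Π` crossed by the unit circle
centered at `q`. -/
def crossCount (q : Plane) (Pi : Finset (Set Plane)) : ℕ :=
  {σ : Set Plane | σ ∈ Pi ∧ Crosses q σ}.ncard


namespace PT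

/-- upper unit arc of `q` as a function -/
def g (q : ℝ × ℝ) (x : ℝ) : ℝ := q.2 + Real.sqrt (1 - (x - q.1) ^ 2)

/-- upper unit arc clipped from below at `Y` -/
def f (Y : ℝ) (q : ℝ × ℝ) (x : ℝ) : ℝ := max Y (g q x)

lemma g_cont2 : Continuous (fun z : (ℝ × ℝ) × ℝ => g z.1 z.2) := by
  unfold g; fun_prop

lemma g_cont (q : ℝ × ℝ) : Continuous (g q) := by
  unfold g; fun_prop

lemma f_cont (Y : ℝ) (q : ℝ × ℝ) : Continuous (f Y q) := by
  unfold f; exact continuous_const.max (g_cont q)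

lemma f_ge (Y : ℝ) (q : ℝ × ℝ) (x : ℝ) : Y ≤ f Y q x := le_max_left _ _
lemma g_le_f (Y : ℝ) (q : ℝ × ℝ) (x : ℝ) : g q x ≤ f Y q x := le_max_right _ _
lemma f_eq_g {Y : ℝ} {q : ℝ × ℝ} {x : ℝ} (h : Y < f Y q x) : f Y q x = g q x := by
  unfold f at *
  rcases le_total Y (g q x) with h1 | h1
  · exact max_eq_right h1
  · rw [max_eq_left h1] at h; exact absurd h (lt_irrefl _)

/-- the half circle function is concave -/
lemma phi_concave : StrictConcaveOn ℝ (Set.Icc (-1) 1) (fun x : ℝ => Real.sqrt (1 - x ^ 2)) := by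
  refine ⟨convex_Icc _ _, ?_⟩
  intro x hx y hy hxy a b ha hb hab
  simp only [smul_eq_mul]
  obtain ⟨hx1, hx2⟩ := hx
  obtain ⟨hy1, hy2⟩ := hy
  have hx3 : 0 ≤ 1 - x ^ 2 := by nlinarith
  have hy3 : 0 ≤ 1 - y ^ 2 := by nlinarith
  apply Real.lt_sqrt_of_sq_lt
  have e1 := Real.sq_sqrt hx3
  have e2 := Real.sq_sqrt hy3
  set s := Real.sqrt (1 - x ^ 2)
  set r := Real.sqrt (1 - y ^ 2)
  have hb' : b = 1 - a := by linarith
  have hpos : 0 < (x - y) ^ 2 := by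
    have : x - y ≠ 0 := sub_ne_zero.mpr hxy
    positivity
  have hab2 : 0 < a * b := mul_pos ha hb
  have key : (a * s + b * r) ^ 2 + (a * x + b * y) ^ 2 + a * b * ((s - r) ^ 2 + (x - y) ^ 2) = 1 := by
    have : (a * s + b * r) ^ 2 + (a * x + b * y) ^ 2 + a * b * ((s - r) ^ 2 + (x - y) ^ 2)
        = (a + b) * (a * (s ^ 2 + x ^ 2) + b * (r ^ 2 + y ^ 2)) := by ring
    rw [this, e1, e2, hab]
    linear_combination hab
  nlinarith [mul_nonneg hab2.le (sq_nonneg (s - r)), mul_pos hab2 hpos]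

lemma phi_incr {s s' d : ℝ} (h1 : -1 ≤ s') (h2 : s + d ≤ 1) (hs : s' ≤ s) (hd : 0 ≤ d) :
    Real.sqrt (1 - (s + d) ^ 2) + Real.sqrt (1 - s' ^ 2) ≤
      Real.sqrt (1 - s ^ 2) + Real.sqrt (1 - (s' + d) ^ 2) := by
  rcases eq_or_lt_of_le (show 0 ≤ s - s' + d by linarith) with h | h
  · have e1 : s = s' := by linarith
    have e2 : d = 0 := by linarith
    subst e1; subst e2; simp
  have hc := phi_concave.concaveOn
  set L := s - s' + d with hL
  have hA : (0:ℝ) ≤ d / L := by positivity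
  have hB : (0:ℝ) ≤ (s - s') / L := div_nonneg (by linarith) h.le
  have hAB : d / L + (s - s') / L = 1 := by rw [← add_div]; rw [div_eq_one_iff_eq h.ne']; rw [hL]; ring
  have m1 : s' ∈ Set.Icc (-1:ℝ) 1 := ⟨h1, by linarith⟩
  have m2 : s + d ∈ Set.Icc (-1:ℝ) 1 := ⟨by linarith, h2⟩
  have i1 := hc.2 m1 m2 hA hB hAB
  have i2 := hc.2 m1 m2 hB hA (by linarith)
  simp only [smul_eq_mul] at i1 i2
  have p1 : d / L * s' + (s - s') / L * (s + d) = s := by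
    field_simp; rw [hL]; ring
  have p2 : (s - s') / L * s' + d / L * (s + d) = s' + d := by
    field_simp; rw [hL]; ring
  rw [p1] at i1; rw [p2] at i2
  nlinarith [Real.sqrt_nonneg (1 - s' ^ 2), Real.sqrt_nonneg (1 - (s + d) ^ 2)]

lemma phi_incr_lt {s s' d : ℝ} (h1 : -1 ≤ s') (h2 : s + d ≤ 1) (hs : s' < s) (hd : 0 < d) :
    Real.sqrt (1 - (s + d) ^ 2) + Real.sqrt (1 - s' ^ 2) <
      Real.sqrt (1 - s ^ 2) + Real.sqrt (1 - (s' + d) ^ 2) := by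
  have h : 0 < s - s' + d := by linarith
  have hc := phi_concave
  set L := s - s' + d with hL
  have hA : (0:ℝ) < d / L := by positivity
  have hB : (0:ℝ) < (s - s') / L := div_pos (by linarith) h
  have hAB : d / L + (s - s') / L = 1 := by rw [← add_div]; rw [div_eq_one_iff_eq h.ne']; rw [hL]; ring
  have m1 : s' ∈ Set.Icc (-1:ℝ) 1 := ⟨h1, by linarith⟩
  have m2 : s + d ∈ Set.Icc (-1:ℝ) 1 := ⟨by linarith, h2⟩
  have hne : s' ≠ s + d := by linarith
  have i1 := hc.2 m1 m2 hne hA hB hAB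
  have i2 := hc.2 m1 m2 hne hB hA (by linarith)
  simp only [smul_eq_mul] at i1 i2
  have p1 : d / L * s' + (s - s') / L * (s + d) = s := by
    field_simp; rw [hL]; ring
  have p2 : (s - s') / L * s' + d / L * (s + d) = s' + d := by
    field_simp; rw [hL]; ring
  rw [p1] at i1; rw [p2] at i2
  nlinarith [Real.sqrt_nonneg (1 - s' ^ 2), Real.sqrt_nonneg (1 - (s + d) ^ 2)]

/-- the difference of two arcs is monotone -/
lemma g_diff_mono {a b : ℝ × ℝ} {x y : ℝ} (hab : a.1 ≤ b.1) (hxy : x ≤ y)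
    (h1 : b.1 - 1 ≤ x) (h2 : y ≤ a.1 + 1) : g b x - g a x ≤ g b y - g a y := by
  have := phi_incr (s := x - a.1) (s' := x - b.1) (d := y - x) (by linarith) (by linarith)
    (by linarith) (by linarith)
  unfold g
  rw [show x - a.1 + (y - x) = y - a.1 by ring, show x - b.1 + (y - x) = y - b.1 by ring] at this
  linarith

lemma g_diff_strict {a b : ℝ × ℝ} {x y : ℝ} (hab : a.1 < b.1) (hxy : x < y)
    (h1 : b.1 - 1 ≤ x) (h2 : y ≤ a.1 + 1) : g b x - g a x < g b y - g a y := by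
  have := phi_incr_lt (s := x - a.1) (s' := x - b.1) (d := y - x) (by linarith) (by linarith)
    (by linarith) (by linarith)
  unfold g
  rw [show x - a.1 + (y - x) = y - a.1 by ring, show x - b.1 + (y - x) = y - b.1 by ring] at this
  linarith

/-- two arcs do not meet in a V shape -/
lemma no_V {a z : ℝ × ℝ} {x1 x2 x3 : ℝ} (h12 : x1 ≤ x2) (h23 : x2 ≤ x3)
    (ha1 : a.1 - 1 ≤ x1) (ha3 : x3 ≤ a.1 + 1) (hz1 : z.1 - 1 ≤ x1) (hz3 : x3 ≤ z.1 + 1)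
    (d1 : g a x1 < g z x1) (d2 : g z x2 ≤ g a x2) (d3 : g a x3 < g z x3) : False := by
  rcases le_total a.1 z.1 with h | h
  · have := g_diff_mono h h12 hz1 (by linarith)
    linarith
  · have := g_diff_mono h h23 (by linarith) (by linarith)
    linarith

lemma dom_of_lt {Y : ℝ} {q : ℝ × ℝ} {x : ℝ} (hq : q.2 ≤ Y) (h : Y < g q x) :
    (x - q.1) ^ 2 < 1 := by
  by_contra hc
  push Not at hc
  have : Real.sqrt (1 - (x - q.1) ^ 2) = 0 := Real.sqrt_eq_zero_of_nonpos (by linarith)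
  unfold g at h
  linarith

lemma abs_dom {x a : ℝ} (h : (x - a) ^ 2 < 1) : a - 1 < x ∧ x < a + 1 := by
  constructor <;> nlinarith

/-- two distinct arcs meet at most once above `Y` -/
lemma cross_unique {Y : ℝ} {a b : ℝ × ℝ} (ha : a.2 ≤ Y) (hb : b.2 ≤ Y) (hne : a ≠ b) {x y : ℝ}
    (hx : f Y a x = f Y b x) (hxY : Y < f Y a x) (hy : f Y a y = f Y b y) (hyY : Y < f Y a y) :
    x = y := by
  have ex1 := f_eq_g hxY
  have ex2 := f_eq_g (hx ▸ hxY)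
  have ey1 := f_eq_g hyY
  have ey2 := f_eq_g (hy ▸ hyY)
  have dxa := abs_dom (dom_of_lt ha (ex1 ▸ hxY))
  have dya := abs_dom (dom_of_lt ha (ey1 ▸ hyY))
  have dxb := abs_dom (dom_of_lt hb (by rw [← ex2, ← hx]; exact hxY : Y < g b x))
  have dyb := abs_dom (dom_of_lt hb (by rw [← ey2, ← hy]; exact hyY : Y < g b y))
  have gx : g a x = g b x := by rw [← ex1, ← ex2, hx]
  have gy : g a y = g b y := by rw [← ey1, ← ey2, hy]
  by_contra hxy
  rcases lt_trichotomy a.1 b.1 with h | h | h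
  · rcases lt_or_gt_of_ne hxy with h' | h'
    · have := g_diff_strict h h' (by linarith) (by linarith); linarith
    · have := g_diff_strict h h' (by linarith) (by linarith); linarith
  · apply hne
    refine Prod.ext h ?_
    unfold g at gx
    rw [h] at gx
    linarith
  · rcases lt_or_gt_of_ne hxy with h' | h'
    · have := g_diff_strict h h' (by linarith) (by linarith); linarith
    · have := g_diff_strict h h' (by linarith) (by linarith); linarith

def endL (Y : ℝ) (q : ℝ × ℝ) : ℝ := q.1 - Real.sqrt (1 - (Y - q.2) ^ 2)
def endR (Y : ℝ) (q : ℝ × ℝ) : ℝ := q.1 + Real.sqrt (1 - (Y - q.2) ^ 2)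

lemma f_gt_iff {Y : ℝ} {q : ℝ × ℝ} (hq : q.2 ≤ Y) (x : ℝ) :
    Y < f Y q x ↔ endL Y q < x ∧ x < endR Y q := by
  have : Y < f Y q x ↔ Y < g q x := by unfold f; simp
  rw [this]
  unfold g endL endR
  have h1 : Y < q.2 + Real.sqrt (1 - (x - q.1) ^ 2) ↔ Y - q.2 < Real.sqrt (1 - (x - q.1) ^ 2) := by
    constructor <;> intro h <;> linarith
  rw [h1, Real.lt_sqrt (by linarith)]
  have h2 : (Y - q.2) ^ 2 < 1 - (x - q.1) ^ 2 ↔ |x - q.1| < Real.sqrt (1 - (Y - q.2) ^ 2) := by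
    rw [Real.lt_sqrt (abs_nonneg _), sq_abs]
    constructor <;> intro h <;> linarith
  rw [h2, abs_lt]
  constructor <;> rintro ⟨h, h'⟩ <;> constructor <;> linarith

/-- abscissa of the intersection above `Y` (junk if there is none) -/
def crossX (Y : ℝ) (a b : ℝ × ℝ) : ℝ :=
  if h : ∃ x, f Y a x = f Y b x ∧ Y < f Y a x then h.choose else 0

lemma crossX_eq {Y : ℝ} {a b : ℝ × ℝ} (ha : a.2 ≤ Y) (hb : b.2 ≤ Y) (hne : a ≠ b) {x : ℝ}
    (hx : f Y a x = f Y b x) (hxY : Y < f Y a x) : x = crossX Y a b := by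
  have h : ∃ x, f Y a x = f Y b x ∧ Y < f Y a x := ⟨x, hx, hxY⟩
  unfold crossX
  rw [dif_pos h]
  exact cross_unique ha hb hne hx hxY h.choose_spec.1 h.choose_spec.2

def Ev (Y : ℝ) (a b : ℝ × ℝ) : Finset ℝ :=
  {endL Y a, endR Y a, endL Y b, endR Y b, crossX Y a b}

lemma Ev_card (Y : ℝ) (a b : ℝ × ℝ) : (Ev Y a b).card ≤ 5 := Finset.card_le_five

lemma mem_Ev_of_eq {Y : ℝ} {a b : ℝ × ℝ} (ha : a.2 ≤ Y) (hb : b.2 ≤ Y) (hne : a ≠ b) {x : ℝ}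
    (hx : f Y a x = f Y b x) (hxY : Y < f Y a x) : x ∈ Ev Y a b := by
  rw [crossX_eq ha hb hne hx hxY]; simp [Ev]

lemma end_const {Y : ℝ} {q : ℝ × ℝ} (hq : q.2 ≤ Y) {u v : ℝ}
    (h1 : ¬ (u < endL Y q ∧ endL Y q < v)) (h2 : ¬ (u < endR Y q ∧ endR Y q < v)) :
    (∀ x, u < x → x < v → Y < f Y q x) ∨ (∀ x, u < x → x < v → f Y q x = Y) := by
  by_cases h : endL Y q ≤ u ∧ v ≤ endR Y q
  · left
    intro x hx hx'
    rw [f_gt_iff hq]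
    exact ⟨by linarith, by linarith⟩
  · right
    intro x hx hx'
    refine le_antisymm ?_ (f_ge _ _ _)
    by_contra hc
    push Not at hc
    rw [f_gt_iff hq] at hc
    apply h
    constructor
    · by_contra h3; push Not at h3; exact h1 ⟨h3, by linarith⟩
    · by_contra h3; push Not at h3; exact h2 ⟨by linarith, h3⟩

/-- sign of the difference of two continuous functions without common values -/
lemma sign_const {F G : ℝ → ℝ} (hF : Continuous F) (hG : Continuous G) {u v : ℝ}
    (h : ∀ x, u < x → x < v → F x ≠ G x) :
    (∀ x, u < x → x < v → F x < G x) ∨ (∀ x, u < x → x < v → G x < F x) := by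
  by_contra hc
  push Not at hc
  obtain ⟨⟨x, hx1, hx2, hx⟩, ⟨y, hy1, hy2, hy⟩⟩ := hc
  have hpre : IsPreconnected (Set.Ioo u v) := isPreconnected_Ioo
  obtain ⟨z, hz, hz'⟩ := hpre.intermediate_value₂ (f := G) (g := F) ⟨hx1, hx2⟩ ⟨hy1, hy2⟩
    hG.continuousOn hF.continuousOn hx hy
  exact h z hz.1 hz.2 hz'.symm

lemma order_const {Y : ℝ} {a b : ℝ × ℝ} (ha : a.2 ≤ Y) (hb : b.2 ≤ Y) {u v : ℝ}
    (h : ∀ x ∈ Ev Y a b, ¬ (u < x ∧ x < v)) :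
    (∀ x, u < x → x < v → f Y a x < f Y b x) ∨ (∀ x, u < x → x < v → f Y b x < f Y a x) ∨
    (∀ x, u < x → x < v → f Y a x = f Y b x) := by
  by_cases hne : a = b
  · subst hne; right; right; intros; rfl
  have c1 := end_const ha (h (endL Y a) (by simp [Ev])) (h (endR Y a) (by simp [Ev]))
  have c2 := end_const hb (h (endL Y b) (by simp [Ev])) (h (endR Y b) (by simp [Ev]))
  rcases c1 with c1 | c1 <;> rcases c2 with c2 | c2
  · rcases sign_const (f_cont Y a) (f_cont Y b) (u := u) (v := v) (by
      intro x hx hx' he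
      exact h x (mem_Ev_of_eq ha hb hne he (c1 x hx hx')) ⟨hx, hx'⟩) with h | h
    · left; exact h
    · right; left; exact h
  · right; left; intro x hx hx'; rw [c2 x hx hx']; exact c1 x hx hx'
  · left; intro x hx hx'; rw [c1 x hx hx']; exact c2 x hx hx'
  · right; right; intro x hx hx'; rw [c1 x hx hx', c2 x hx hx']

end PT

namespace PT

structure Cell where
  bot : ℝ × ℝ
  top : ℝ × ℝ
  u : ℝ
  v : ℝ

/-- the arc of `q` enters the open cell -/
def Conf (Y : ℝ) (q : ℝ × ℝ) (δ : Cell) : Prop :=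
  ∃ x, δ.u < x ∧ x < δ.v ∧ f Y δ.bot x < f Y q x ∧ f Y q x < f Y δ.top x

/-- closed cell -/
def InCell (Y : ℝ) (p : ℝ × ℝ) (δ : Cell) : Prop :=
  δ.u ≤ p.1 ∧ p.1 ≤ δ.v ∧ f Y δ.bot p.1 ≤ p.2 ∧ p.2 ≤ f Y δ.top p.1

structure IsCell (Y : ℝ) (fl : ℝ × ℝ) (uL uR : ℝ) (R : Finset (ℝ × ℝ)) (p : ℝ × ℝ) (δ : Cell) :
    Prop where
  top_mem : δ.top ∈ R
  top_gt : p.2 < f Y δ.top p.1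
  top_min : ∀ c ∈ R, p.2 < f Y c p.1 → f Y δ.top p.1 ≤ f Y c p.1
  bot_mem : δ.bot ∈ R
  bot_lt : f Y δ.bot p.1 < p.2
  bot_max : ∀ c ∈ R, f Y c p.1 < p.2 → f Y c p.1 ≤ f Y δ.bot p.1
  bot_fl : f Y δ.bot p.1 = Y → δ.bot = fl
  hu : δ.u < p.1
  hv : p.1 < δ.v
  huL : uL ≤ δ.u
  hvR : δ.v ≤ uR
  free : ∀ c ∈ R, ∀ x ∈ Ev Y δ.bot c ∪ Ev Y δ.top c, ¬ (δ.u < x ∧ x < δ.v)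
  u_ev : δ.u = uL ∨ ∃ c ∈ R, δ.u ∈ Ev Y δ.bot c ∪ Ev Y δ.top c
  v_ev : δ.v = uR ∨ ∃ c ∈ R, δ.v ∈ Ev Y δ.bot c ∪ Ev Y δ.top c

structure Gen (Y : ℝ) (uL uR : ℝ) (R : Finset (ℝ × ℝ)) (p : ℝ × ℝ) : Prop where
  hY : Y < p.2
  ne : ∀ c ∈ R, f Y c p.1 ≠ p.2
  nev : ∀ c ∈ R, ∀ d ∈ R, p.1 ∉ Ev Y c d
  hL : uL < p.1
  hR : p.1 < uR

lemma Gen.mono {Y uL uR : ℝ} {R S : Finset (ℝ × ℝ)} {p : ℝ × ℝ} (h : Gen Y uL uR S p)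
    (hRS : R ⊆ S) : Gen Y uL uR R p :=
  ⟨h.hY, fun c hc => h.ne c (hRS hc), fun c hc d hd => h.nev c (hRS hc) d (hRS hd), h.hL, h.hR⟩

section
variable {Y : ℝ} {fl tp : ℝ × ℝ} {uL uR : ℝ} {R : Finset (ℝ × ℝ)} {p : ℝ × ℝ}

lemma exists_cell (hfl : fl ∈ R) (hflY : ∀ x, f Y fl x = Y) (htp : tp ∈ R)
    (hG : Gen Y uL uR R p) (htpp : p.2 < f Y tp p.1) :
    ∃ δ, IsCell Y fl uL uR R p δ := by
  obtain ⟨top, ht, htmin⟩ := Finset.exists_min_image (R.filter (fun c => p.2 < f Y c p.1))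
    (fun c => f Y c p.1) ⟨tp, by simp [htp, htpp]⟩
  have hb : ∃ bot ∈ R, f Y bot p.1 < p.2 ∧ (∀ c ∈ R, f Y c p.1 < p.2 → f Y c p.1 ≤ f Y bot p.1) ∧
      (f Y bot p.1 = Y → bot = fl) := by
    by_cases h : ∃ c ∈ R, f Y c p.1 < p.2 ∧ Y < f Y c p.1
    · obtain ⟨c0, hc0, hc1, hc2⟩ := h
      obtain ⟨bot, hb, hbmax⟩ := Finset.exists_max_image (R.filter (fun c => f Y c p.1 < p.2))
        (fun c => f Y c p.1) ⟨c0, by simp [hc0, hc1]⟩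
      rw [Finset.mem_filter] at hb
      refine ⟨bot, hb.1, hb.2, fun c hc hcp => hbmax c (by simp [hc, hcp]), ?_⟩
      intro he
      have := hbmax c0 (by simp [hc0, hc1])
      linarith
    · push Not at h
      refine ⟨fl, hfl, by rw [hflY]; exact hG.hY, ?_, fun _ => rfl⟩
      intro c hc hcp
      rw [hflY]
      exact h c hc hcp
  obtain ⟨bot, hb1, hb2, hb3, hb4⟩ := hb
  rw [Finset.mem_filter] at ht
  set E : Finset ℝ := R.biUnion (fun c => Ev Y bot c ∪ Ev Y top c) with hE
  have hpE : ∀ x ∈ E, x ≠ p.1 := by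
    intro x hx he
    subst he
    rw [hE, Finset.mem_biUnion] at hx
    obtain ⟨c, hc, hx⟩ := hx
    rw [Finset.mem_union] at hx
    rcases hx with hx | hx
    · exact hG.nev _ hb1 _ hc hx
    · exact hG.nev _ ht.1 _ hc hx
  obtain ⟨u, hu, humax⟩ := Finset.exists_max_image ((insert uL E).filter (fun x => x < p.1)) id
    ⟨uL, by simp [hG.hL]⟩
  obtain ⟨v, hv, hvmin⟩ := Finset.exists_min_image ((insert uR E).filter (fun x => p.1 < x)) id
    ⟨uR, by simp [hG.hR]⟩
  rw [Finset.mem_filter, Finset.mem_insert] at hu hv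
  refine ⟨⟨bot, top, u, v⟩, ht.1, ht.2, fun c hc h => htmin c (by simp [hc, h]), hb1, hb2, hb3, hb4,
    hu.2, hv.2, humax uL (by simp [hG.hL]), hvmin uR (by simp [hG.hR]), ?_, ?_, ?_⟩
  · rintro c hc x hx ⟨h1, h2⟩
    simp only at h1 h2 hx
    have hxE : x ∈ E := by rw [hE, Finset.mem_biUnion]; exact ⟨c, hc, hx⟩
    rcases lt_or_gt_of_ne (hpE x hxE) with h | h
    · have := humax x (by simp [hxE, h]); simp only [id] at this; linarith
    · have := hvmin x (by simp [hxE, h]); simp only [id] at this; linarith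
  · rcases hu.1 with h | h
    · exact Or.inl h
    · right; rw [hE, Finset.mem_biUnion] at h; exact h
  · rcases hv.1 with h | h
    · exact Or.inl h
    · right; rw [hE, Finset.mem_biUnion] at h; exact h


lemma cell_v_eq (hRY : ∀ c ∈ R, c.2 ≤ Y)
    {p' : ℝ × ℝ} {δ δ' : Cell} (h : IsCell Y fl uL uR R p δ)
    (h' : IsCell Y fl uL uR R p' δ') (hb : δ.bot = δ'.bot) (ht : δ.top = δ'.top) (hu : δ.u = δ'.u) :
    δ = δ' := by
  have key : ∀ {p p' : ℝ × ℝ} {δ δ' : Cell}, IsCell Y fl uL uR R p δ →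
    IsCell Y fl uL uR R p' δ' → δ.bot = δ'.bot → δ.top = δ'.top → δ.u = δ'.u → δ.v < δ'.v → False := by
    intro p p' δ δ' h h' hb ht hu hv
    rcases h.v_ev with h1 | ⟨c, hc, h1⟩
    · have := h'.hvR; linarith
    · rw [hb, ht] at h1
      refine h'.free c hc _ h1 ⟨?_, hv⟩
      rw [← hu]; exact h.hu.trans h.hv
  have : δ.v = δ'.v := by
    rcases lt_trichotomy δ.v δ'.v with h1 | h1 | h1
    · exact (key h h' hb ht hu h1).elim
    · exact h1
    · exact (key h' h hb.symm ht.symm hu.symm h1).elim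
  cases δ; cases δ'; simp_all

lemma cell_unique (hRY : ∀ c ∈ R, c.2 ≤ Y)
    (hG : Gen Y uL uR R p) {δ δ' : Cell} (h : IsCell Y fl uL uR R p δ)
    (h' : IsCell Y fl uL uR R p δ') : δ = δ' := by
  have ht : δ.top = δ'.top := by
    by_contra hne
    have e := le_antisymm (h.top_min _ h'.top_mem h'.top_gt) (h'.top_min _ h.top_mem h.top_gt)
    exact hG.nev _ h.top_mem _ h'.top_mem (mem_Ev_of_eq (hRY _ h.top_mem) (hRY _ h'.top_mem) hne e
      (hG.hY.trans h.top_gt))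
  have hb : δ.bot = δ'.bot := by
    by_contra hne
    have e := le_antisymm (h'.bot_max _ h.bot_mem h.bot_lt) (h.bot_max _ h'.bot_mem h'.bot_lt)
    rcases eq_or_lt_of_le (f_ge Y δ.bot p.1) with h1 | h1
    · exact hne ((h.bot_fl h1.symm).trans (h'.bot_fl (by rw [← e, ← h1])).symm)
    · exact hG.nev _ h.bot_mem _ h'.bot_mem (mem_Ev_of_eq (hRY _ h.bot_mem) (hRY _ h'.bot_mem) hne e
        h1)
  have key : ∀ {δ δ' : Cell}, IsCell Y fl uL uR R p δ →
    IsCell Y fl uL uR R p δ' → δ.bot = δ'.bot → δ.top = δ'.top → δ.u < δ'.u → False := by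
    intro δ δ' h h' hb ht hu
    rcases h'.u_ev with h1 | ⟨c, hc, h1⟩
    · have := h.huL; linarith
    · rw [← hb, ← ht] at h1
      exact h.free c hc _ h1 ⟨hu, h'.hu.trans h.hv⟩
  have hu : δ.u = δ'.u := by
    rcases lt_trichotomy δ.u δ'.u with h1 | h1 | h1
    · exact (key h h' hb ht h1).elim
    · exact h1
    · exact (key h' h hb.symm ht.symm h1).elim
  exact cell_v_eq hRY h h' hb ht hu

lemma cell_bot_lt_top (hRY : ∀ c ∈ R, c.2 ≤ Y) {δ : Cell} (h : IsCell Y fl uL uR R p δ) :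
    ∀ x, δ.u < x → x < δ.v → f Y δ.bot x < f Y δ.top x := by
  have hp : f Y δ.bot p.1 < f Y δ.top p.1 := h.bot_lt.trans h.top_gt
  rcases order_const (hRY _ h.bot_mem) (hRY _ h.top_mem) (u := δ.u) (v := δ.v)
    (fun x hx => h.free δ.top h.top_mem x (Finset.mem_union_left _ hx)) with h1 | h1 | h1
  · exact h1
  · have := h1 p.1 h.hu h.hv; linarith
  · have := h1 p.1 h.hu h.hv; linarith

lemma cell_sides (hRY : ∀ c ∈ R, c.2 ≤ Y)
    (hG : Gen Y uL uR R p) {δ : Cell} (h : IsCell Y fl uL uR R p δ) {c : ℝ × ℝ}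
    (hc : c ∈ R) :
    (∀ x, δ.u < x → x < δ.v → f Y c x ≤ f Y δ.bot x) ∨
    (∀ x, δ.u < x → x < δ.v → f Y δ.top x ≤ f Y c x) := by
  rcases lt_or_gt_of_ne (hG.ne c hc) with h0 | h0
  · left
    have hp := h.bot_max c hc h0
    rcases order_const (hRY _ h.bot_mem) (hRY _ hc) (u := δ.u) (v := δ.v)
      (fun x hx => h.free c hc x (Finset.mem_union_left _ hx)) with h1 | h1 | h1
    · have := h1 p.1 h.hu h.hv; linarith
    · intro x hx hx'; exact (h1 x hx hx').le
    · intro x hx hx'; exact (h1 x hx hx').ge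
  · right
    have hp := h.top_min c hc h0
    rcases order_const (hRY _ h.top_mem) (hRY _ hc) (u := δ.u) (v := δ.v)
      (fun x hx => h.free c hc x (Finset.mem_union_right _ hx)) with h1 | h1 | h1
    · intro x hx hx'; exact (h1 x hx hx').le
    · have := h1 p.1 h.hu h.hv; linarith
    · intro x hx hx'; exact (h1 x hx hx').le

lemma cell_not_conf (hRY : ∀ c ∈ R, c.2 ≤ Y)
    (hG : Gen Y uL uR R p) {δ : Cell} (h : IsCell Y fl uL uR R p δ) {c : ℝ × ℝ}
    (hc : c ∈ R) : ¬ Conf Y c δ := by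
  rintro ⟨x, h1, h2, h3, h4⟩
  rcases cell_sides hRY hG h hc with h5 | h5
  · have := h5 x h1 h2; linarith
  · have := h5 x h1 h2; linarith

lemma cell_key_top (hRY : ∀ c ∈ R, c.2 ≤ Y)
    {p' : ℝ × ℝ} (hfl : fl ∈ R) (hflY : ∀ x, f Y fl x = Y)
    (hG : Gen Y uL uR R p) (hG' : Gen Y uL uR R p') {δ δ' : Cell}
    (h : IsCell Y fl uL uR R p δ) (h' : IsCell Y fl uL uR R p' δ')
    (ht : δ.top = δ'.top) (hu : δ.u = δ'.u) : δ = δ' := by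
  refine cell_v_eq hRY h h' ?_ ht hu
  have huv : δ.u < min δ.v δ'.v := lt_min (h.hu.trans h.hv) (by rw [hu]; exact h'.hu.trans h'.hv)
  obtain ⟨x, hx1, hx2⟩ := exists_between huv
  have hxv : x < δ.v := hx2.trans_le (min_le_left _ _)
  have hxv' : x < δ'.v := hx2.trans_le (min_le_right _ _)
  have hx1' : δ'.u < x := hu ▸ hx1
  have e : f Y δ.bot x = f Y δ'.bot x := by
    apply le_antisymm
    · rcases cell_sides hRY hG' h' h.bot_mem with h5 | h5
      · exact h5 x hx1' hxv'
      · have := h5 x hx1' hxv'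
        have := cell_bot_lt_top hRY h x hx1 hxv
        rw [ht] at this; linarith
    · rcases cell_sides hRY hG h h'.bot_mem with h5 | h5
      · exact h5 x hx1 hxv
      · have := h5 x hx1 hxv
        have := cell_bot_lt_top hRY h' x hx1' hxv'
        rw [← ht] at this; linarith
  by_contra hne
  have hxY : f Y δ.bot x = Y := by
    by_contra hc
    have hlt := lt_of_le_of_ne (f_ge Y δ.bot x) (Ne.symm hc)
    have := mem_Ev_of_eq (hRY _ h.bot_mem) (hRY _ h'.bot_mem) hne e hlt
    exact h.free _ h'.bot_mem x (Finset.mem_union_left _ this) ⟨hx1, hxv⟩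
  have key : ∀ {p : ℝ × ℝ} {δ : Cell}, IsCell Y fl uL uR R p δ → δ.u < x → x < δ.v →
      f Y δ.bot x = Y → δ.bot = fl := by
    intro p δ h hx1 hxv hxY
    apply h.bot_fl
    rcases order_const (hRY _ h.bot_mem) (hRY _ hfl) (u := δ.u) (v := δ.v)
      (fun x hx => h.free fl hfl x (Finset.mem_union_left _ hx)) with h1 | h1 | h1
    · have := h1 x hx1 hxv; rw [hflY] at this; linarith
    · have := h1 x hx1 hxv; rw [hflY] at this; linarith
    · rw [h1 p.1 h.hu h.hv, hflY]
  exact hne ((key h hx1 hxv hxY).trans (key h' hx1' hxv' (e ▸ hxY)).symm)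

lemma cell_key_bot (hRY : ∀ c ∈ R, c.2 ≤ Y) {p' : ℝ × ℝ}
    (hG : Gen Y uL uR R p) (hG' : Gen Y uL uR R p') {δ δ' : Cell}
    (h : IsCell Y fl uL uR R p δ) (h' : IsCell Y fl uL uR R p' δ')
    (hb : δ.bot = δ'.bot) (hu : δ.u = δ'.u) : δ = δ' := by
  refine cell_v_eq hRY h h' hb ?_ hu
  have huv : δ.u < min δ.v δ'.v := lt_min (h.hu.trans h.hv) (by rw [hu]; exact h'.hu.trans h'.hv)
  obtain ⟨x, hx1, hx2⟩ := exists_between huv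
  have hxv : x < δ.v := hx2.trans_le (min_le_left _ _)
  have hxv' : x < δ'.v := hx2.trans_le (min_le_right _ _)
  have hx1' : δ'.u < x := hu ▸ hx1
  have e : f Y δ.top x = f Y δ'.top x := by
    apply le_antisymm
    · rcases cell_sides hRY hG h h'.top_mem with h5 | h5
      · have := h5 x hx1 hxv
        have := cell_bot_lt_top hRY h' x hx1' hxv'
        rw [← hb] at this; linarith
      · exact h5 x hx1 hxv
    · rcases cell_sides hRY hG' h' h.top_mem with h5 | h5
      · have := h5 x hx1' hxv'
        have := cell_bot_lt_top hRY h x hx1 hxv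
        rw [hb] at this; linarith
      · exact h5 x hx1' hxv'
  by_contra hne
  have hlt : Y < f Y δ.top x := (f_ge Y δ.bot x).trans_lt (cell_bot_lt_top hRY h x hx1 hxv)
  have := mem_Ev_of_eq (hRY _ h.top_mem) (hRY _ h'.top_mem) hne e hlt
  exact h.free _ h'.top_mem x (Finset.mem_union_right _ this) ⟨hx1, hxv⟩

/-- backward analysis: the cell is determined by at most four arcs -/
lemma cell_definers {δ : Cell} (h : IsCell Y fl uL uR R p δ) :
    ∃ D : Finset (ℝ × ℝ), D.card ≤ 4 ∧ ∀ S ⊆ R, (∀ d ∈ R, d ∈ D → d ∈ S) →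
      IsCell Y fl uL uR S p δ := by
  have hu : ∃ cu : ℝ × ℝ, δ.u = uL ∨ (cu ∈ R ∧ δ.u ∈ Ev Y δ.bot cu ∪ Ev Y δ.top cu) := by
    rcases h.u_ev with h1 | ⟨c, hc, h1⟩
    · exact ⟨0, Or.inl h1⟩
    · exact ⟨c, Or.inr ⟨hc, h1⟩⟩
  have hv : ∃ cv : ℝ × ℝ, δ.v = uR ∨ (cv ∈ R ∧ δ.v ∈ Ev Y δ.bot cv ∪ Ev Y δ.top cv) := by
    rcases h.v_ev with h1 | ⟨c, hc, h1⟩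
    · exact ⟨0, Or.inl h1⟩
    · exact ⟨c, Or.inr ⟨hc, h1⟩⟩
  obtain ⟨cu, hcu⟩ := hu
  obtain ⟨cv, hcv⟩ := hv
  refine ⟨{δ.top, δ.bot, cu, cv}, Finset.card_le_four, ?_⟩
  intro S hS hD
  refine ⟨hD _ h.top_mem (by simp), h.top_gt, fun c hc => h.top_min c (hS hc),
    hD _ h.bot_mem (by simp), h.bot_lt, fun c hc => h.bot_max c (hS hc), h.bot_fl, h.hu, h.hv, h.huL,
    h.hvR, fun c hc => h.free c (hS hc), ?_, ?_⟩
  · rcases hcu with h1 | ⟨h1, h2⟩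
    · exact Or.inl h1
    · exact Or.inr ⟨cu, hD _ h1 (by simp), h2⟩
  · rcases hcv with h1 | ⟨h1, h2⟩
    · exact Or.inl h1
    · exact Or.inr ⟨cv, hD _ h1 (by simp), h2⟩

end
end PT

namespace PT

lemma avg_lemma {V : Type*} [Fintype V] [Nonempty V] (w : V → ℝ) (hw : ∀ v, 0 < w v) (t : ℕ)
    (F : (Fin t → V) → V → ℝ) (B : ℝ)
    (h : ∀ l : Fin (t+1) → V, ∑ i, F (i.removeNth l) (l i) ≤ B) :
    ∃ l : Fin t → V, ∑ q, w q * F l q ≤ B * (∑ q, w q) / (t + 1) := by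
  by_contra hcon
  push Not at hcon
  set W := ∑ q, w q with hW
  have h1 : ∀ i : Fin (t+1), ∑ l : Fin (t+1) → V, (∏ j, w (l j)) * F (i.removeNth l) (l i)
      = ∑ l : Fin t → V, (∏ j, w (l j)) * ∑ q, w q * F l q := by
    intro i
    rw [← (Fin.insertNthEquiv (fun _ => V) i).sum_comp, Fintype.sum_prod_type_right]
    refine Finset.sum_congr rfl fun l _ => ?_
    rw [Finset.mul_sum]
    refine Finset.sum_congr rfl fun q _ => ?_
    rw [Fin.prod_univ_succAbove _ i]
    simp [Fin.insertNthEquiv]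
    ring
  have h2 : ∑ l : Fin (t+1) → V, (∏ j, w (l j)) * ∑ i, F (i.removeNth l) (l i)
      = (t+1) * ∑ l : Fin t → V, (∏ j, w (l j)) * ∑ q, w q * F l q := by
    simp_rw [Finset.mul_sum]
    rw [Finset.sum_comm]
    rw [Finset.sum_congr rfl (fun i _ => h1 i)]
    simp [Finset.mul_sum]
  have hp : ∀ k, ∑ l : Fin k → V, (∏ j, w (l j)) = W ^ k := by
    intro k
    rw [hW, Fintype.sum_pow]
  have h3 : ∑ l : Fin (t+1) → V, (∏ j, w (l j)) * ∑ i, F (i.removeNth l) (l i) ≤ B * W^(t+1) := by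
    rw [← hp, Finset.mul_sum]
    refine Finset.sum_le_sum fun l _ => ?_
    rw [mul_comm B]
    exact mul_le_mul_of_nonneg_left (h l) (Finset.prod_nonneg fun j _ => (hw _).le)
  have h4 : ∑ l : Fin t → V, (∏ j, w (l j)) * (B * W / (t+1)) <
      ∑ l : Fin t → V, (∏ j, w (l j)) * ∑ q, w q * F l q := by
    refine Finset.sum_lt_sum_of_nonempty Finset.univ_nonempty fun l _ => ?_
    exact mul_lt_mul_of_pos_left (hcon l) (Finset.prod_pos fun j _ => hw _)
  rw [← Finset.sum_mul, hp] at h4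
  rw [h2] at h3
  have ht : (0:ℝ) < t + 1 := by positivity
  have h5 := mul_lt_mul_of_pos_left h4 ht
  have : (t+1:ℝ) * (W^t * (B * W / (t+1))) = B * W^(t+1) := by field_simp; ring
  linarith
end PT

namespace PT

def cl (Y : ℝ) (fl : ℝ × ℝ) (uL uR : ℝ) (R : Finset (ℝ × ℝ)) (p : ℝ × ℝ) : Cell :=
  if h : ∃ δ, IsCell Y fl uL uR R p δ then h.choose else ⟨0, 0, 0, 0⟩

/-- base data -/
structure Base (Y : ℝ) (fl tp : ℝ × ℝ) (Q : Finset (ℝ × ℝ)) : Prop where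
  hQ : ∀ c ∈ Q, c.2 ≤ Y
  fl2 : fl.2 ≤ Y
  tp2 : tp.2 ≤ Y
  flY : ∀ x, f Y fl x = Y

def ext (fl tp : ℝ × ℝ) (Q : Finset (ℝ × ℝ)) : Finset (ℝ × ℝ) := insert fl (insert tp Q)

lemma Base.hE {Y : ℝ} {fl tp : ℝ × ℝ} {Q : Finset (ℝ × ℝ)} (hb : Base Y fl tp Q) :
    ∀ c ∈ ext fl tp Q, c.2 ≤ Y := by
  intro c hc
  simp only [ext, Finset.mem_insert] at hc
  rcases hc with rfl | rfl | hc
  · exact hb.fl2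
  · exact hb.tp2
  · exact hb.hQ c hc

/-- weight of conflicting arcs -/
def cw (Y : ℝ) (Q : Finset (ℝ × ℝ)) (w : ℝ × ℝ → ℝ) (δ : Cell) : ℝ :=
  ∑ q ∈ Q, if Conf Y q δ then w q else 0

def GenP (Y uL uR : ℝ) (fl tp : ℝ × ℝ) (Q : Finset (ℝ × ℝ)) (p : ℝ × ℝ) : Prop :=
  Gen Y uL uR (ext fl tp Q) p ∧ p.2 < f Y tp p.1

section
variable {Y : ℝ} {fl tp : ℝ × ℝ} {uL uR : ℝ} {Q : Finset (ℝ × ℝ)}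

lemma cl_spec {p : ℝ × ℝ} (hb : Base Y fl tp Q) (hp : GenP Y uL uR fl tp Q p) {R : Finset (ℝ × ℝ)}
    (hR : R ⊆ ext fl tp Q) (hfl : fl ∈ R) (htp : tp ∈ R) :
    IsCell Y fl uL uR R p (cl Y fl uL uR R p) := by
  have h := exists_cell hfl hb.flY htp (hp.1.mono hR) hp.2
  rw [cl, dif_pos h]
  exact h.choose_spec

def Rt (fl tp : ℝ × ℝ) {t : ℕ} (l : Fin t → {c // c ∈ Q}) : Finset (ℝ × ℝ) :=
  insert fl (insert tp (Finset.univ.image (fun j => (l j).1)))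

lemma Rt_sub {t : ℕ} (l : Fin t → {c // c ∈ Q}) : Rt fl tp l ⊆ ext fl tp Q := by
  intro c hc
  simp only [Rt, ext, Finset.mem_insert, Finset.mem_image, Finset.mem_univ, true_and] at hc ⊢
  rcases hc with h | h | ⟨j, rfl⟩
  · exact Or.inl h
  · exact Or.inr (Or.inl h)
  · exact Or.inr (Or.inr (l j).2)

lemma four_bound (hb : Base Y fl tp Q) {p : ℝ × ℝ} (hp : GenP Y uL uR fl tp Q p) {t : ℕ}
    (l : Fin (t+1) → {c // c ∈ Q}) :
    (Finset.univ.filter (fun i : Fin (t+1) =>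
      Conf Y (l i).1 (cl Y fl uL uR (Rt fl tp (i.removeNth l)) p))).card ≤ 4 := by
  have hS := cl_spec hb hp (Rt_sub (fl := fl) (tp := tp) l) (by simp [Rt]) (by simp [Rt])
  obtain ⟨D, hD, hDS⟩ := cell_definers hS
  have hsub : ∀ i : Fin (t+1), Rt fl tp (i.removeNth l) ⊆ Rt fl tp l := by
    intro i c hc
    simp only [Rt, Finset.mem_insert, Finset.mem_image, Finset.mem_univ, true_and] at hc ⊢
    rcases hc with h | h | ⟨j, h⟩
    · exact Or.inl h
    · exact Or.inr (Or.inl h)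
    · exact Or.inr (Or.inr ⟨_, h⟩)
  have hRY : ∀ {t : ℕ} (l : Fin t → {c // c ∈ Q}), ∀ c ∈ Rt fl tp l, c.2 ≤ Y :=
    fun l c hc => hb.hE c (Rt_sub l hc)
  refine le_trans ?_ hD
  refine Finset.card_le_card_of_injOn (fun i => (l i).1) ?_ ?_
  · intro i hi
    simp only [Finset.coe_filter, Finset.mem_univ, true_and, Set.mem_ofPred_eq] at hi
    show (l i).1 ∈ D
    by_contra hnD
    have h1 := hDS (Rt fl tp (i.removeNth l)) (hsub i) (by
      intro d hd hdD
      simp only [Rt, Finset.mem_insert, Finset.mem_image, Finset.mem_univ, true_and] at hd ⊢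
      rcases hd with h | h | ⟨j, h⟩
      · exact Or.inl h
      · exact Or.inr (Or.inl h)
      · rcases Fin.eq_self_or_eq_succAbove i j with rfl | ⟨k, rfl⟩
        · rw [h] at hnD; exact absurd hdD hnD
        · exact Or.inr (Or.inr ⟨k, h⟩))
    have h2 := cl_spec hb hp (Rt_sub (fl := fl) (tp := tp) (i.removeNth l)) (by simp [Rt]) (by simp [Rt])
    have h3 := cell_unique (hRY _) (hp.1.mono (Rt_sub _)) h1 h2
    rw [← h3] at hi
    exact cell_not_conf (hRY _) (hp.1.mono (Rt_sub _)) hS (by simp [Rt]) hi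
  · intro i hi j hj hij
    simp only [Finset.coe_filter, Finset.mem_univ, true_and, Set.mem_ofPred_eq] at hi hj
    by_contra hne
    rcases Fin.eq_self_or_eq_succAbove i j with rfl | ⟨k, hk⟩
    · exact hne rfl
    · have h2 := cl_spec hb hp (Rt_sub (fl := fl) (tp := tp) (i.removeNth l)) (by simp [Rt]) (by simp [Rt])
      refine cell_not_conf (hRY _) (hp.1.mono (Rt_sub _)) h2 ?_ hi
      simp only at hij
      rw [hij, hk]
      simp only [Rt, Finset.mem_insert, Finset.mem_image, Finset.mem_univ, true_and]
      exact Or.inr (Or.inr ⟨k, rfl⟩)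

lemma sample (hb : Base Y fl tp Q) (hQne : Q.Nonempty) (w : ℝ × ℝ → ℝ) (hw : ∀ q, 0 < w q)
    {ι : Type*} (P : Finset ι) (ps : ι → ℝ × ℝ) (hP : ∀ p ∈ P, GenP Y uL uR fl tp Q (ps p)) (t : ℕ) :
    ∃ R : Finset (ℝ × ℝ), R ⊆ ext fl tp Q ∧ fl ∈ R ∧ tp ∈ R ∧ R.card ≤ t + 2 ∧
      ∑ p ∈ P, cw Y Q w (cl Y fl uL uR R (ps p)) ≤ 4 * P.card * (∑ q ∈ Q, w q) / (t + 1) := by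
  have : Nonempty {c // c ∈ Q} := ⟨⟨_, hQne.choose_spec⟩⟩
  obtain ⟨l, hl⟩ := avg_lemma (fun q : {c // c ∈ Q} => w q.1) (fun q => hw _) t
    (fun l q => ∑ p ∈ P, if Conf Y q.1 (cl Y fl uL uR (Rt fl tp l) (ps p)) then 1 else 0)
    (4 * P.card) (by
      intro l
      rw [Finset.sum_comm]
      calc _ ≤ ∑ p ∈ P, (4:ℝ) := by
            refine Finset.sum_le_sum fun p hp => ?_
            rw [Finset.sum_boole]
            exact_mod_cast four_bound hb (hP p hp) l
        _ = _ := by simp [mul_comm])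
  refine ⟨Rt fl tp l, Rt_sub l, by simp [Rt], by simp [Rt], ?_, ?_⟩
  · refine (Finset.card_insert_le _ _).trans ?_
    have := Finset.card_insert_le tp (Finset.univ.image (fun j => (l j).1))
    have h2 := Finset.card_image_le (s := Finset.univ) (f := fun j => (l j).1)
    simp at h2
    omega
  · rw [Finset.sum_coe_sort Q w] at hl
    refine le_trans (le_of_eq ?_) hl
    simp_rw [Finset.mul_sum]
    rw [Finset.sum_comm]
    refine Finset.sum_congr rfl fun p _ => ?_
    rw [cw, ← Finset.sum_coe_sort Q]
    refine Finset.sum_congr rfl fun q _ => ?_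
    split_ifs <;> simp
end
end PT

namespace PT

section
variable {Y : ℝ} {fl tp : ℝ × ℝ} {uL uR : ℝ} {Q : Finset (ℝ × ℝ)}

def EvS (Y : ℝ) (fl tp : ℝ × ℝ) (uL uR : ℝ) (Q : Finset (ℝ × ℝ)) : Finset ℝ :=
  {uL, uR} ∪ (ext fl tp Q ×ˢ ext fl tp Q).biUnion (fun e => Ev Y e.1 e.2)

lemma mem_EvS {b t : ℝ × ℝ} (hb : b ∈ ext fl tp Q) (ht : t ∈ ext fl tp Q) {R : Finset (ℝ × ℝ)}
    (hR : R ⊆ ext fl tp Q) {x : ℝ} (hx : ∃ c ∈ R, x ∈ Ev Y b c ∪ Ev Y t c) :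
    x ∈ EvS Y fl tp uL uR Q := by
  obtain ⟨c, hc, h⟩ := hx
  rw [Finset.mem_union] at h
  refine Finset.mem_union_right _ (Finset.mem_biUnion.2 ?_)
  rcases h with h | h
  · exact ⟨(b, c), Finset.mem_product.2 ⟨hb, hR hc⟩, h⟩
  · exact ⟨(t, c), Finset.mem_product.2 ⟨ht, hR hc⟩, h⟩

structure Valid (Y : ℝ) (fl tp : ℝ × ℝ) (uL uR : ℝ) (Q : Finset (ℝ × ℝ)) (δ : Cell) : Prop where
  bot_mem : δ.bot ∈ ext fl tp Q
  top_mem : δ.top ∈ ext fl tp Q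
  hu : uL ≤ δ.u
  huv : δ.u < δ.v
  hv : δ.v ≤ uR
  u_mem : δ.u ∈ EvS Y fl tp uL uR Q
  v_mem : δ.v ∈ EvS Y fl tp uL uR Q
  lt : ∀ x, δ.u < x → x < δ.v → f Y δ.bot x < f Y δ.top x

lemma cells_card (hb : Base Y fl tp Q) {R : Finset (ℝ × ℝ)}
    (hR : R ⊆ ext fl tp Q) (hfl : fl ∈ R) (htp : tp ∈ R)
    {ι : Type*} (P : Finset ι) (ps : ι → ℝ × ℝ) (hP : ∀ p ∈ P, GenP Y uL uR fl tp Q (ps p)) :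
    (P.image (fun p => cl Y fl uL uR R (ps p))).card ≤ 2 * R.card * (1 + 5 * R.card) := by
  set U : ℝ × ℝ → Finset ℝ := fun e => insert uL (R.biUnion (Ev Y e)) with hU
  set K : Finset ((Bool × (ℝ × ℝ)) × ℝ) :=
    ((Finset.univ : Finset Bool) ×ˢ R).biUnion (fun be => (U be.2).image (fun u => (be, u))) with hK
  have hUc : ∀ e, (U e).card ≤ 1 + 5 * R.card := by
    intro e
    refine (Finset.card_insert_le _ _).trans ?_
    have := Finset.card_biUnion_le_card_mul R (Ev Y e) 5 (fun c _ => Ev_card Y e c)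
    omega
  have hKc : K.card ≤ 2 * R.card * (1 + 5 * R.card) := by
    refine (Finset.card_biUnion_le_card_mul _ _ (1 + 5 * R.card) ?_).trans ?_
    · intro be _
      exact Finset.card_image_le.trans (hUc _)
    · simp
  refine le_trans ?_ hKc
  have hRY : ∀ c ∈ R, c.2 ≤ Y := fun c hc => hb.hE c (hR hc)
  set key : Cell → (Bool × (ℝ × ℝ)) × ℝ := fun δ =>
    if δ.u ∈ U δ.bot then ((false, δ.bot), δ.u) else ((true, δ.top), δ.u) with hkey
  have hspec : ∀ p ∈ P, IsCell Y fl uL uR R (ps p) (cl Y fl uL uR R (ps p)) :=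
    fun p hp => cl_spec hb (hP p hp) hR hfl htp
  refine Finset.card_le_card_of_injOn key ?_ ?_
  · intro δ hδ
    rw [Finset.mem_coe, Finset.mem_image] at hδ
    obtain ⟨p, hp, rfl⟩ := hδ
    have h := hspec p hp
    rw [Finset.mem_coe, hK, Finset.mem_biUnion]
    simp only [hkey]
    split_ifs with hc
    · exact ⟨(false, _), by simp [h.bot_mem], Finset.mem_image.2 ⟨_, hc, rfl⟩⟩
    · refine ⟨(true, _), by simp [h.top_mem], Finset.mem_image.2 ⟨_, ?_, rfl⟩⟩
      simp only [hU, Finset.mem_insert, Finset.mem_biUnion] at hc ⊢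
      push Not at hc
      rcases h.u_ev with h1 | ⟨c, h1, h2⟩
      · exact Or.inl h1
      · rw [Finset.mem_union] at h2
        rcases h2 with h2 | h2
        · exact absurd h2 (hc.2 c h1)
        · exact Or.inr ⟨c, h1, h2⟩
  · intro δ hδ δ' hδ' he
    rw [Finset.mem_coe, Finset.mem_image] at hδ hδ'
    obtain ⟨p, hp, rfl⟩ := hδ
    obtain ⟨p', hp', rfl⟩ := hδ'
    have h := hspec p hp
    have h' := hspec p' hp'
    simp only [hkey] at he
    split_ifs at he with h1 h2 h2
    · simp only [Prod.mk.injEq, true_and] at he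
      exact cell_key_bot hRY ((hP p hp).1.mono hR) ((hP p' hp').1.mono hR) h h' he.1 he.2
    · simp at he
    · simp at he
    · simp only [Prod.mk.injEq, true_and] at he
      exact cell_key_top hRY hfl hb.flY ((hP p hp).1.mono hR) ((hP p' hp').1.mono hR) h h' he.1 he.2

lemma good_cell (hb : Base Y fl tp Q) (hQne : Q.Nonempty) (w : ℝ × ℝ → ℝ) (hw : ∀ q, 0 < w q)
    {ι : Type*} (P : Finset ι) (hPne : P.Nonempty) (ps : ι → ℝ × ℝ)
    (hP : ∀ p ∈ P, GenP Y uL uR fl tp Q (ps p)) (k : ℕ)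
    (hk : 1 ≤ k) :
    ∃ δ, Valid Y fl tp uL uR Q δ ∧ ∃ P' ⊆ P, P.card ≤ 88 * k^2 * P'.card ∧
      (∀ p ∈ P', InCell Y (ps p) δ) ∧ cw Y Q w δ ≤ 8 * (∑ q ∈ Q, w q) / k := by
  obtain ⟨t, rfl⟩ : ∃ t, k = t + 1 := ⟨k - 1, by omega⟩
  obtain ⟨R, hR, hfl, htp, hRc, hsum⟩ := sample hb hQne w hw P ps hP t
  set W := ∑ q ∈ Q, w q with hW
  have hWpos : 0 < W := Finset.sum_pos (fun q _ => hw q) hQne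
  have hRY : ∀ c ∈ R, c.2 ≤ Y := fun c hc => hb.hE c (hR hc)
  set c : ι → ℝ := fun p => cw Y Q w (cl Y fl uL uR R (ps p)) with hc
  have hcn : ∀ p, 0 ≤ c p := fun p => Finset.sum_nonneg fun q _ => by
    split_ifs
    · exact (hw q).le
    · exact le_rfl
  set G := P.filter (fun p => c p ≤ 8 * W / (t+1)) with hG
  have hkpos : (0:ℝ) < t + 1 := by positivity
  have hGc : P.card ≤ 2 * G.card := by
    have h1 : ((P.filter (fun p => ¬ c p ≤ 8 * W / (t+1))).card : ℝ) * (8 * W / (t+1)) ≤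
        4 * P.card * W / (t + 1) := by
      refine le_trans ?_ hsum
      rw [← nsmul_eq_mul]
      refine le_trans (Finset.card_nsmul_le_sum _ c _ ?_) ?_
      · intro p hp; rw [Finset.mem_filter] at hp; exact (not_le.1 hp.2).le
      · exact Finset.sum_le_sum_of_subset_of_nonneg (Finset.filter_subset _ _) fun p _ _ => hcn p
    have h2 : G.card + (P.filter (fun p => ¬ c p ≤ 8 * W / (t+1))).card = P.card := by
      rw [hG]; convert Finset.card_filter_add_card_filter_not (s := P) (fun p => c p ≤ 8 * W / (t+1))
    have h3 : 2 * (P.filter (fun p => ¬ c p ≤ 8 * W / (t+1))).card ≤ P.card := by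
      have h4 : ((P.filter (fun p => ¬ c p ≤ 8 * W / (t+1))).card : ℝ) * 2 ≤ P.card := by
        have e1 : ((P.filter (fun p => ¬ c p ≤ 8 * W / (t+1))).card : ℝ) * (8 * W / (t+1)) =
          (((P.filter (fun p => ¬ c p ≤ 8 * W / (t+1))).card : ℝ) * 2) * (4 * W / (t+1)) := by ring
        have e2 : 4 * (P.card:ℝ) * W / (t + 1) = P.card * (4 * W / (t+1)) := by ring
        rw [e1, e2] at h1
        exact le_of_mul_le_mul_right h1 (by positivity)
      have : (P.filter (fun p => ¬ c p ≤ 8 * W / (t+1))).card * 2 ≤ P.card := by exact_mod_cast h4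
      omega
    omega
  set I := P.image (fun p => cl Y fl uL uR R (ps p)) with hI
  have hIc : I.card ≤ 44 * (t+1)^2 := by
    refine (cells_card hb hR hfl htp P ps hP).trans ?_
    calc _ ≤ 2 * (t+2) * (1 + 5 * (t+2)) := by gcongr
      _ ≤ _ := by nlinarith
  have hGne : G.Nonempty := by
    rw [← Finset.card_pos]; have := Finset.card_pos.2 hPne; omega
  have hIne : I.Nonempty := hPne.image _
  have hpig : ∃ δ ∈ I, P.card ≤ 88 * (t+1)^2 *
      (G.filter (fun p => cl Y fl uL uR R (ps p) = δ)).card := by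
    by_contra hcon
    push Not at hcon
    have h1 := Finset.card_eq_sum_card_fiberwise (f := fun p => cl Y fl uL uR R (ps p)) (s := G) (t := I)
      (fun p hp => Finset.mem_image_of_mem _ (Finset.mem_of_mem_filter p hp))
    have h2 : ∑ δ ∈ I, 88 * (t+1)^2 * (G.filter (fun p => cl Y fl uL uR R (ps p) = δ)).card <
        ∑ δ ∈ I, P.card := Finset.sum_lt_sum_of_nonempty hIne hcon
    rw [← Finset.mul_sum, ← h1, Finset.sum_const, smul_eq_mul] at h2
    have h3 : I.card * P.card ≤ 44 * (t+1)^2 * (2 * G.card) := Nat.mul_le_mul hIc hGc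
    have h4 : 44 * (t+1)^2 * (2 * G.card) = 88 * (t+1)^2 * G.card := by ring
    omega
  obtain ⟨δ, hδI, hδ⟩ := hpig
  set P' := G.filter (fun p => cl Y fl uL uR R (ps p) = δ) with hP'
  have hspec : ∀ p ∈ P, IsCell Y fl uL uR R (ps p) (cl Y fl uL uR R (ps p)) :=
    fun p hp => cl_spec hb (hP p hp) hR hfl htp
  have hP'mem : ∀ p ∈ P', p ∈ P ∧ c p ≤ 8 * W / (t+1) ∧ cl Y fl uL uR R (ps p) = δ := by
    intro p hp
    rw [hP', Finset.mem_filter, hG, Finset.mem_filter] at hp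
    exact ⟨hp.1.1, hp.1.2, hp.2⟩
  have hP'ne : P'.Nonempty := by
    rw [Finset.nonempty_iff_ne_empty]
    intro h
    rw [h] at hδ
    have := Finset.card_pos.2 hPne
    simp at hδ
    simp [hδ] at hPne
  obtain ⟨p0, hp0⟩ := hP'ne
  obtain ⟨hp1, hp2, hp3⟩ := hP'mem p0 hp0
  have hcell := hspec p0 hp1
  rw [hp3] at hcell
  refine ⟨δ, ⟨hR hcell.bot_mem, hR hcell.top_mem, hcell.huL, hcell.hu.trans hcell.hv, hcell.hvR, hcell.u_ev.elim (fun h => by simp [h, EvS])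
      (mem_EvS (hR hcell.bot_mem) (hR hcell.top_mem) hR), hcell.v_ev.elim (fun h => by simp [h, EvS])
      (mem_EvS (hR hcell.bot_mem) (hR hcell.top_mem) hR),
    cell_bot_lt_top hRY hcell⟩, P', fun p hp => (hP'mem p hp).1, hδ, ?_, ?_⟩
  · intro p hp
    obtain ⟨h1, h2, h3⟩ := hP'mem p hp
    have h := hspec p h1
    rw [h3] at h
    exact ⟨h.hu.le, h.hv.le, h.bot_lt.le, h.top_gt.le⟩
  · simp only [hc, hp3] at hp2
    push_cast
    exact hp2

lemma trap_star (hb : Base Y fl tp Q) (hQne : Q.Nonempty) (hLR : uL < uR)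
    (htpY : ∀ x, uL < x → x < uR → Y < f Y tp x) (w : ℝ × ℝ → ℝ) (hw : ∀ q, 0 < w q)
    {ι : Type*} (P : Finset ι) (ps : ι → ℝ × ℝ)
    (hP : ∀ p ∈ P, GenP Y uL uR fl tp Q (ps p)) (m s : ℕ) (hm : 1 ≤ m) (hs : 1 ≤ s)
    (hms : m * s ≤ P.card) :
    ∃ δ, Valid Y fl tp uL uR Q δ ∧ ∃ P' ⊆ P, P'.card = s ∧
      (∀ p ∈ P', InCell Y (ps p) δ) ∧ cw Y Q w δ ≤ 160 / Real.sqrt m * (∑ q ∈ Q, w q) := by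
  have hms1 : 1 ≤ m * s := Nat.mul_pos hm hs
  have hPne : P.Nonempty := by rw [← Finset.card_pos]; omega
  have hWpos : 0 < ∑ q ∈ Q, w q := Finset.sum_pos (fun q _ => hw q) hQne
  have hsm : 0 < Real.sqrt m := Real.sqrt_pos.2 (by exact_mod_cast hm)
  suffices h : ∃ δ, Valid Y fl tp uL uR Q δ ∧ ∃ P' ⊆ P, s ≤ P'.card ∧
      (∀ p ∈ P', InCell Y (ps p) δ) ∧ cw Y Q w δ ≤ 160 / Real.sqrt m * (∑ q ∈ Q, w q) by
    obtain ⟨δ, h1, P', h2, h3, h4, h5⟩ := h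
    obtain ⟨P'', h6, h7⟩ := Finset.exists_subset_card_eq h3
    exact ⟨δ, h1, P'', h6.trans h2, h7, fun p hp => h4 p (h6 hp), h5⟩
  have hmsq : Real.sqrt m < Nat.sqrt m + 1 := by
    rw [Real.sqrt_lt' (by positivity)]
    exact_mod_cast (by rw [pow_two]; exact Nat.lt_succ_sqrt m : m < (Nat.sqrt m + 1)^2)
  set r := Nat.sqrt m with hr
  rcases Nat.eq_zero_or_pos (r / 10) with h0 | h0
  · have hr10 : r < 10 := by omega
    refine ⟨⟨fl, tp, uL, uR⟩, ⟨by simp [ext], by simp [ext], le_rfl, hLR, le_rfl, by simp [EvS],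
      by simp [EvS], ?_⟩, P, subset_rfl,
      by nlinarith, ?_, ?_⟩
    · intro x h1 h2
      simp only [hb.flY]
      exact htpY x h1 h2
    · intro p hp
      have h := hP p hp
      exact ⟨h.1.hL.le, h.1.hR.le, by simp only [hb.flY]; exact h.1.hY.le, h.2.le⟩
    · have h1 : cw Y Q w ⟨fl, tp, uL, uR⟩ ≤ ∑ q ∈ Q, w q := by
        refine Finset.sum_le_sum fun q _ => ?_
        split_ifs
        · exact le_rfl
        · exact (hw q).le
      refine h1.trans (le_mul_of_one_le_left hWpos.le ?_)
      rw [le_div_iff₀ hsm]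
      have : (r:ℝ) < 10 := by exact_mod_cast hr10
      linarith
  · set k := r / 10 with hk
    obtain ⟨δ, h1, P', h2, h3, h4, h5⟩ := good_cell hb hQne w hw P hPne ps hP k h0
    refine ⟨δ, h1, P', h2, ?_, h4, h5.trans ?_⟩
    · have hrm : r * r ≤ m := Nat.sqrt_le m
      have hkr : 10 * k ≤ r := by omega
      have h6 : 88 * k^2 ≤ m := by nlinarith
      by_contra hlt
      push Not at hlt
      have : 88 * k^2 * P'.card ≤ m * P'.card := Nat.mul_le_mul_right _ h6
      have : m * P'.card < m * s := Nat.mul_lt_mul_of_pos_left hlt hm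
      omega
    · have hkr : r + 1 ≤ 20 * k := by omega
      have hkr' : (r:ℝ) + 1 ≤ 20 * k := by exact_mod_cast hkr
      have hk0 : (0:ℝ) < k := by exact_mod_cast h0
      rw [mul_comm 8, mul_div_assoc, mul_comm]
      refine mul_le_mul_of_nonneg_right ?_ hWpos.le
      rw [div_le_div_iff₀ hk0 hsm]
      nlinarith
end
end PT

namespace PT

section
variable {Y : ℝ} {fl tp : ℝ × ℝ} {uL uR : ℝ} {Q : Finset (ℝ × ℝ)}

/-- position of actual points -/
structure Pos (Y : ℝ) (tp : ℝ × ℝ) (uL uR : ℝ) (p : ℝ × ℝ) : Prop where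
  hY : Y ≤ p.2
  hL : uL < p.1
  hR : p.1 < uR
  ht : p.2 < f Y tp p.1

lemma isClosed_inCell (δ : Cell) : IsClosed {p : ℝ × ℝ | InCell Y p δ} := by
  have c1 : Continuous (fun p : ℝ × ℝ => f Y δ.bot p.1) := (f_cont _ _).comp continuous_fst
  have c2 : Continuous (fun p : ℝ × ℝ => f Y δ.top p.1) := (f_cont _ _).comp continuous_fst
  exact (isClosed_le continuous_const continuous_fst).inter
    ((isClosed_le continuous_fst continuous_const).inter
      ((isClosed_le c1 continuous_snd).inter (isClosed_le continuous_snd c2)))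

lemma exists_star (Q : Finset (ℝ × ℝ)) (fl : ℝ × ℝ) {p : ℝ × ℝ} (hp : Pos Y tp uL uR p) :
    ∃ p' : ℝ × ℝ, GenP Y uL uR fl tp Q p' ∧ ∀ δ, Valid Y fl tp uL uR Q δ → InCell Y p' δ →
      InCell Y p δ := by
  set Z : Finset Cell := ((ext fl tp Q ×ˢ ext fl tp Q) ×ˢ
    (EvS Y fl tp uL uR Q ×ˢ EvS Y fl tp uL uR Q)).image
    (fun a => ⟨a.1.1, a.1.2, a.2.1, a.2.2⟩) with hZ
  set C : Set (ℝ × ℝ) := ⋃ δ ∈ Z.filter (fun δ => ¬ InCell Y p δ), {p | InCell Y p δ} with hC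
  have hCc : IsClosed C := Set.Finite.isClosed_biUnion (Finset.finite_toSet _)
    (fun δ _ => isClosed_inCell δ)
  have hpC : p ∉ C := by
    rw [hC]
    simp only [Set.mem_iUnion, not_exists]
    intro δ hδ
    rw [Finset.mem_filter] at hδ
    exact hδ.2
  have c2 : Continuous (fun p : ℝ × ℝ => f Y tp p.1) := (f_cont _ _).comp continuous_fst
  have hO : IsOpen (Cᶜ ∩ {p : ℝ × ℝ | uL < p.1 ∧ p.1 < uR ∧ p.2 < f Y tp p.1}) :=
    hCc.isOpen_compl.inter ((isOpen_lt continuous_const continuous_fst).inter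
      ((isOpen_lt continuous_fst continuous_const).inter (isOpen_lt continuous_snd c2)))
  obtain ⟨ε, hε, hball⟩ := Metric.isOpen_iff.1 hO p ⟨hpC, hp.hL, hp.hR, hp.ht⟩
  obtain ⟨x, hx, hxn⟩ := (Set.Ioo_infinite (show p.1 < p.1 + ε by linarith)).exists_notMem_finset
    (EvS Y fl tp uL uR Q)
  obtain ⟨y, hy, hyn⟩ := (Set.Ioo_infinite (show p.2 < p.2 + ε by linarith)).exists_notMem_finset
    ((ext fl tp Q).image (fun c => f Y c x))
  have hin : ((x, y) : ℝ × ℝ) ∈ Metric.ball p ε := by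
    rw [Metric.mem_ball, Prod.dist_eq, max_lt_iff, Real.dist_eq, Real.dist_eq, abs_lt, abs_lt]
    simp only
    refine ⟨⟨?_, ?_⟩, ?_, ?_⟩ <;> linarith [hx.1, hx.2, hy.1, hy.2]
  obtain ⟨h1, h2, h3, h4⟩ := hball hin
  refine ⟨(x, y), ⟨⟨?_, ?_, ?_, h2, h3⟩, h4⟩, ?_⟩
  · simp only; linarith [hp.hY, hy.1]
  · intro c hc he
    exact hyn (Finset.mem_image.2 ⟨c, hc, he⟩)
  · intro c hc d hd he
    exact hxn (Finset.mem_union_right _ (Finset.mem_biUnion.2 ⟨(c, d), Finset.mem_product.2 ⟨hc, hd⟩, he⟩))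
  · intro δ hδ hI
    by_contra hn
    apply h1
    rw [hC]
    simp only [Set.mem_iUnion]
    refine ⟨δ, Finset.mem_filter.2 ⟨?_, hn⟩, hI⟩
    rw [hZ, Finset.mem_image]
    exact ⟨((δ.bot, δ.top), (δ.u, δ.v)), by simp [hδ.bot_mem, hδ.top_mem, hδ.u_mem, hδ.v_mem], rfl⟩

lemma trap (hb : Base Y fl tp Q) (hQne : Q.Nonempty) (hLR : uL < uR)
    (htpY : ∀ x, uL < x → x < uR → Y < f Y tp x) (w : ℝ × ℝ → ℝ) (hw : ∀ q, 0 < w q)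
    {ι : Type*} (P : Finset ι) (ps : ι → ℝ × ℝ)
    (hP : ∀ p, Pos Y tp uL uR (ps p)) (m s : ℕ) (hm : 1 ≤ m) (hs : 1 ≤ s)
    (hms : m * s ≤ P.card) :
    ∃ δ, Valid Y fl tp uL uR Q δ ∧ ∃ P' ⊆ P, P'.card = s ∧
      (∀ p ∈ P', InCell Y (ps p) δ) ∧ cw Y Q w δ ≤ 160 / Real.sqrt m * (∑ q ∈ Q, w q) := by
  choose ps' h1 h2 using fun i => exists_star Q fl (hP i)
  obtain ⟨δ, h3, P', h4, h5, h6, h7⟩ := trap_star hb hQne hLR htpY w hw P ps' (fun p _ => h1 p) m s hm hs hms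
  exact ⟨δ, h3, P', h4, h5, fun p hp => h2 p δ h3 (h6 p hp), h7⟩

/-- the reweighting induction -/
lemma partition_ind (hb : Base Y fl tp Q) (hQne : Q.Nonempty) (hLR : uL < uR)
    (htpY : ∀ x, uL < x → x < uR → Y < f Y tp x)
    {ι : Type*} (ps : ι → ℝ × ℝ)
    (hP : ∀ p, Pos Y tp uL uR (ps p)) (s : ℕ) (hs : 1 ≤ s) (m : ℕ) :
    ∀ (P : Finset ι) (w : ℝ × ℝ → ℝ), (∀ q, 0 < w q) → (m + 1) * s ≤ P.card → P.card < (m + 2) * s →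
    ∃ (col : ι → Fin (m+1)) (δ : Fin (m+1) → Cell),
      (∀ i, Valid Y fl tp uL uR Q (δ i)) ∧
      (∀ p ∈ P, InCell Y (ps p) (δ (col p))) ∧
      (∀ i, s ≤ (P.filter (fun p => col p = i)).card ∧ (P.filter (fun p => col p = i)).card < 2 * s) ∧
      ∑ q ∈ Q, w q * 2 ^ (Finset.univ.filter (fun i => Conf Y q (δ i))).card ≤
        (∑ q ∈ Q, w q) * Real.exp (320 * Real.sqrt (m+1)) := by
  induction m with
  | zero =>
    intro P w hw h1 h2
    refine ⟨fun _ => 0, fun _ => ⟨fl, tp, uL, uR⟩, fun i => ⟨by simp [ext], by simp [ext], le_rfl, hLR,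
      le_rfl, by simp [EvS], by simp [EvS], ?_⟩, ?_, ?_, ?_⟩
    · intro x h1 h2
      simp only [hb.flY]
      exact htpY x h1 h2
    · intro p hp
      have h := hP p
      exact ⟨h.hL.le, h.hR.le, by simp only [hb.flY]; exact h.hY, h.ht.le⟩
    · intro i
      rw [Finset.filter_true_of_mem (fun p _ => (Fin.fin_one_eq_zero i).symm)]
      omega
    · rw [Finset.sum_mul]
      refine Finset.sum_le_sum fun q _ => mul_le_mul_of_nonneg_left ?_ (hw q).le
      calc _ ≤ (2:ℝ) ^ 1 := by
            refine pow_le_pow_right₀ (by norm_num) ?_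
            exact (Finset.card_le_univ _).trans (by simp)
        _ ≤ 320 + 1 := by norm_num
        _ ≤ _ := by simpa using Real.add_one_le_exp (320:ℝ)
  | succ m ih =>
    intro P w hw h1 h2
    obtain ⟨δ0, hv0, P', hP', hc', hin', hcw⟩ := trap hb hQne hLR htpY w hw P ps hP (m+1+1) s (by omega) hs h1
    have hsd := Finset.card_sdiff_of_subset hP'
    obtain ⟨col, δ, hv, hin, hcard, hsum⟩ := ih (P \ P')
      (fun q => w q * (if Conf Y q δ0 then 2 else 1)) (fun q => by
        have := hw q
        split_ifs <;> linarith) (by rw [hsd, hc']; apply Nat.le_sub_of_add_le; linarith)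
        (by rw [hsd, hc']; apply Nat.sub_lt_left_of_lt_add <;> nlinarith)
    refine ⟨fun p => if p ∈ P' then 0 else (col p).succ, Fin.cons δ0 δ, ?_, ?_, ?_, ?_⟩
    · intro i
      refine Fin.cases ?_ (fun i => ?_) i
      · exact hv0
      · exact hv i
    · intro p hp
      by_cases h : p ∈ P'
      · simp only [h, if_true, Fin.cons_zero]; exact hin' p h
      · simp only [h, if_false, Fin.cons_succ]; exact hin p (Finset.mem_sdiff.2 ⟨hp, h⟩)
    · intro i
      refine Fin.cases ?_ (fun i => ?_) i
      · have : P.filter (fun p => (if p ∈ P' then (0 : Fin (m+1+1)) else (col p).succ) = 0) = P' := by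
          ext p
          rw [Finset.mem_filter]
          by_cases h : p ∈ P'
          · simp [h, hP' h]
          · simp [h, Fin.succ_ne_zero]
        rw [this]; omega
      · have : P.filter (fun p => (if p ∈ P' then (0 : Fin (m+1+1)) else (col p).succ) = i.succ) =
            (P \ P').filter (fun p => col p = i) := by
          ext p
          rw [Finset.mem_filter, Finset.mem_filter, Finset.mem_sdiff]
          by_cases h : p ∈ P'
          · simp [h, (Fin.succ_ne_zero _).symm]
          · simp [h]
        rw [this]; exact hcard i
    · have hcnt : ∀ q, (Finset.univ.filter (fun i => Conf Y q ((Fin.cons δ0 δ : Fin (m+1+1) → Cell) i))).card =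
          (if Conf Y q δ0 then 1 else 0) + (Finset.univ.filter (fun i => Conf Y q (δ i))).card := by
        intro q
        rw [Finset.card_filter, Fin.sum_univ_succ, Finset.card_filter]
        simp
      have hW : ∑ q ∈ Q, w q * (if Conf Y q δ0 then (2:ℝ) else 1) = ∑ q ∈ Q, w q + cw Y Q w δ0 := by
        rw [cw, ← Finset.sum_add_distrib]
        refine Finset.sum_congr rfl fun q _ => ?_
        split_ifs <;> ring
      have hWpos : 0 < ∑ q ∈ Q, w q := Finset.sum_pos (fun q _ => hw q) hQne
      calc _ = ∑ q ∈ Q, w q * (if Conf Y q δ0 then 2 else 1) *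
            2 ^ (Finset.univ.filter (fun i => Conf Y q (δ i))).card := by
            refine Finset.sum_congr rfl fun q _ => ?_
            rw [hcnt]
            split_ifs <;> ring
        _ ≤ _ := hsum
        _ ≤ ((∑ q ∈ Q, w q) * (1 + 160 / Real.sqrt (m+1+1))) * Real.exp (320 * Real.sqrt (m+1)) := by
            rw [hW]
            refine mul_le_mul_of_nonneg_right ?_ (Real.exp_pos _).le
            push_cast at hcw
            linarith
        _ ≤ ((∑ q ∈ Q, w q) * Real.exp (160 / Real.sqrt (m+1+1))) * Real.exp (320 * Real.sqrt (m+1)) := by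
            gcongr
            linarith [Real.add_one_le_exp (160 / Real.sqrt (m+1+1))]
        _ ≤ _ := by
            rw [mul_assoc, ← Real.exp_add]
            refine mul_le_mul_of_nonneg_left (Real.exp_le_exp.2 ?_) hWpos.le
            push_cast
            set a := Real.sqrt ((m:ℝ)+1) with ha
            set b := Real.sqrt ((m:ℝ)+1+1) with hbb
            have hb0 : 0 < b := Real.sqrt_pos.2 (by positivity)
            have ha0 : 0 ≤ a := Real.sqrt_nonneg _
            have ha2 : a^2 = m + 1 := Real.sq_sqrt (by positivity)
            have hb2 : b^2 = m + 1 + 1 := Real.sq_sqrt (by positivity)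
            rw [← le_sub_iff_add_le, div_le_iff₀ hb0]
            nlinarith [sq_nonneg (b-a)]

lemma partition_lemma (hb : Base Y fl tp Q) (hQne : Q.Nonempty) (hLR : uL < uR)
    (htpY : ∀ x, uL < x → x < uR → Y < f Y tp x)
    {ι : Type*} [Fintype ι] (ps : ι → ℝ × ℝ)
    (hP : ∀ p, Pos Y tp uL uR (ps p)) (s : ℕ) (hs : 1 ≤ s) (m : ℕ) (hm : 1 ≤ m)
    (h1 : m * s ≤ Fintype.card ι) (h2 : Fintype.card ι < (m+1) * s) :
    ∃ (col : ι → Fin m) (δ : Fin m → Cell),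
      (∀ i, Valid Y fl tp uL uR Q (δ i)) ∧
      (∀ p, InCell Y (ps p) (δ (col p))) ∧
      (∀ i, s ≤ (Finset.univ.filter (fun p => col p = i)).card ∧
        (Finset.univ.filter (fun p => col p = i)).card < 2 * s) ∧
      ∀ q ∈ Q, ∀ r : ℕ, Q.card ≤ 2 ^ r →
        ((Finset.univ.filter (fun i => Conf Y q (δ i))).card : ℝ) ≤ r + 480 * Real.sqrt m := by
  obtain ⟨m, rfl⟩ : ∃ k, m = k + 1 := ⟨m - 1, by omega⟩
  obtain ⟨col, δ, hv, hin, hc, hsum⟩ := partition_ind hb hQne hLR htpY ps hP s hs m Finset.univ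
    (fun _ => 1) (fun _ => one_pos) (by simpa using h1) (by simpa using h2)
  refine ⟨col, δ, hv, fun p => hin p (Finset.mem_univ p), hc, ?_⟩
  intro q hq r hr
  simp only [one_mul, Finset.sum_const, nsmul_eq_mul, mul_one] at hsum
  set k := (Finset.univ.filter (fun i => Conf Y q (δ i))).card with hk
  have h3 : (2:ℝ)^k ≤ 2 ^ r * Real.exp (320 * Real.sqrt (m+1)) := by
    refine (Finset.single_le_sum (f := fun q => (2:ℝ)^(Finset.univ.filter (fun i => Conf Y q (δ i))).card)
      (fun q _ => by positivity) hq).trans (hsum.trans ?_)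
    gcongr
    exact_mod_cast hr
  have h4 := Real.log_le_log (by positivity) h3
  rw [Real.log_mul (by positivity) (by positivity), Real.log_exp, Real.log_pow, Real.log_pow] at h4
  have hl := Real.log_two_gt_d9
  push_cast
  have hs0 := Real.sqrt_nonneg ((m:ℝ)+1)
  by_contra hcon
  push Not at hcon
  nlinarith
end
end PT

namespace PT

lemma fiber_bound {ι : Type*} [Fintype ι] {t : ℕ} (I : Finset (Fin t))
    (Bad : (Fin t → ι) → Finset ι) (hloc : ∀ N N', (∀ i ∈ I, N i = N' i) → Bad N = Bad N')
    (ε : ℝ) (hε : 0 ≤ ε) (hε1 : ε ≤ 1) (hI : I.card ≤ 6) (ht : 6 ≤ t) :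
    ((Finset.univ.filter (fun N : Fin t → ι => (∀ i, N i ∉ Bad N) ∧
      ε * Fintype.card ι < (Bad N).card)).card : ℝ) ≤ (Fintype.card ι : ℝ)^t * (1-ε)^(t-6) := by
  set n := Fintype.card ι with hn
  set e := Equiv.piEquivPiSubtypeProd (fun i => i ∈ I) (fun _ : Fin t => ι) with he
  have hc1 : Fintype.card {i // i ∈ I} = I.card := by simp
  have hc2 : Fintype.card {i // ¬ i ∈ I} = t - I.card := by
    rw [Fintype.card_subtype_compl]; simp
  have hfib : ∀ a : ({i // i ∈ I} → ι), ((Finset.univ.filter (fun b : {i // ¬ i ∈ I} → ι =>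
      (∀ i, e.symm (a,b) i ∉ Bad (e.symm (a,b))) ∧ ε * n < (Bad (e.symm (a,b))).card)).card : ℝ) ≤
      ((1-ε) * n)^(t - I.card) := by
    intro a
    by_cases h : ∃ b0, (∀ i, e.symm (a,b0) i ∉ Bad (e.symm (a,b0))) ∧ ε * n < (Bad (e.symm (a,b0))).card
    · obtain ⟨b0, h1, h2⟩ := h
      set B := Bad (e.symm (a,b0)) with hB
      have hBb : ∀ b, Bad (e.symm (a,b)) = B := by
        intro b
        apply hloc
        intro i hi
        simp [he, Equiv.piEquivPiSubtypeProd, hi]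
      have hsub : (Finset.univ.filter (fun b : {i // ¬ i ∈ I} → ι =>
        (∀ i, e.symm (a,b) i ∉ Bad (e.symm (a,b))) ∧ ε * n < (Bad (e.symm (a,b))).card)) ⊆
          Fintype.piFinset (fun _ => Bᶜ) := by
        intro b hb
        rw [Finset.mem_filter] at hb
        rw [Fintype.mem_piFinset]
        intro i
        have := hb.2.1 i.1
        rw [hBb] at this
        rw [Finset.mem_compl]
        have h3 : e.symm (a,b) i.1 = b i := by
          simp [he, Equiv.piEquivPiSubtypeProd, i.2]
        rwa [h3] at this
      have hcard := Finset.card_le_card hsub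
      rw [Fintype.card_piFinset] at hcard
      simp only [Finset.prod_const, Finset.card_univ, hc2, Finset.card_compl] at hcard
      have hBn : B.card ≤ n := Finset.card_le_univ B
      calc _ ≤ (((n - B.card)^(t - I.card) : ℕ) : ℝ) := by exact_mod_cast hcard
        _ = ((n:ℝ) - B.card)^(t-I.card) := by push_cast [Nat.cast_sub hBn]; rfl
        _ ≤ _ := by
          refine pow_le_pow_left₀ ?_ (by linarith) _
          have : (B.card:ℝ) ≤ n := by exact_mod_cast hBn
          linarith
    · push Not at h
      rw [Finset.filter_false_of_mem]
      · simp
        have : 0 ≤ 1 - ε := by linarith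
        positivity
      · intro b _ hb
        have := h b hb.1
        linarith [hb.2]
  have hcount : (Finset.univ.filter (fun N : Fin t → ι => (∀ i, N i ∉ Bad N) ∧
      ε * n < (Bad N).card)).card = ∑ a : ({i // i ∈ I} → ι), (Finset.univ.filter
        (fun b : {i // ¬ i ∈ I} → ι =>
      (∀ i, e.symm (a,b) i ∉ Bad (e.symm (a,b))) ∧ ε * n < (Bad (e.symm (a,b))).card)).card := by
    simp_rw [Finset.card_filter]
    rw [← e.symm.sum_comp, Fintype.sum_prod_type]
  rw [hcount]
  push_cast
  have h1e : 0 ≤ 1 - ε := by linarith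
  calc _ ≤ ∑ a : ({i // i ∈ I} → ι), ((1-ε) * n)^(t - I.card) := Finset.sum_le_sum fun a _ => hfib a
    _ = (n:ℝ)^I.card * ((1-ε) * n)^(t - I.card) := by
      rw [Finset.sum_const, Finset.card_univ, Fintype.card_fun, nsmul_eq_mul, hc1]
      push_cast; rfl
    _ = (n:ℝ)^t * (1-ε)^(t - I.card) := by
      rw [mul_pow, mul_comm ((1-ε)^_), ← mul_assoc, ← pow_add]
      congr 2
      omega
    _ ≤ _ := by
      refine mul_le_mul_of_nonneg_left ?_ (by positivity)
      exact pow_le_pow_of_le_one h1e (by linarith) (by omega)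

lemma net_lemma {ι D : Type*} [Fintype ι] [Nonempty ι] [Fintype D] {t : ℕ} (I : D → Finset (Fin t))
    (Bad : D → (Fin t → ι) → Finset ι)
    (hloc : ∀ d N N', (∀ i ∈ I d, N i = N' i) → Bad d N = Bad d N')
    (ε : ℝ) (hε : 0 ≤ ε) (hε1 : ε ≤ 1) (hI : ∀ d, (I d).card ≤ 6) (ht : 6 ≤ t)
    (hD : (Fintype.card D : ℝ) * (1-ε)^(t-6) < 1) :
    ∃ N : Fin t → ι, ∀ d, (∀ i, N i ∉ Bad d N) → ((Bad d N).card : ℝ) ≤ ε * Fintype.card ι := by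
  by_contra hcon
  push Not at hcon
  have h1 : (Finset.univ : Finset (Fin t → ι)) ⊆ Finset.univ.biUnion (fun d =>
      Finset.univ.filter (fun N : Fin t → ι => (∀ i, N i ∉ Bad d N) ∧
      ε * Fintype.card ι < (Bad d N).card)) := by
    intro N _
    obtain ⟨d, hd⟩ := hcon N
    exact Finset.mem_biUnion.2 ⟨d, Finset.mem_univ _, Finset.mem_filter.2 ⟨Finset.mem_univ _, hd⟩⟩
  have h2 := (Finset.card_le_card h1).trans Finset.card_biUnion_le
  rw [Finset.card_univ, Fintype.card_fun, Fintype.card_fin] at h2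
  have h3 : ((Fintype.card ι : ℝ))^t ≤ ∑ d : D, (Fintype.card ι : ℝ)^t * (1-ε)^(t-6) := by
    have h2' := (Nat.cast_le (α := ℝ)).2 h2
    push_cast at h2'
    refine h2'.trans ?_
    exact Finset.sum_le_sum fun d _ => fiber_bound (I d) (Bad d) (hloc d) ε hε hε1 (hI d) ht
  rw [Finset.sum_const, Finset.card_univ, nsmul_eq_mul] at h3
  have h4 : (0:ℝ) < (Fintype.card ι : ℝ)^t := by
    have : 0 < Fintype.card ι := Fintype.card_pos
    positivity
  nlinarith
end PT

namespace PT

lemma le_Icc_of_Ioo {F G : ℝ → ℝ} (hF : Continuous F) (hG : Continuous G) {u v : ℝ} (huv : u < v)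
    (h : ∀ x, u < x → x < v → F x ≤ G x) : ∀ x ∈ Set.Icc u v, F x ≤ G x := by
  intro x hx
  rw [← closure_Ioo huv.ne] at hx
  exact le_on_closure (fun x hx => h x hx.1 hx.2) hF.continuousOn hG.continuousOn hx

abbrev EvCode (t : ℕ) := (Fin t × Fin t × Fin 3) ⊕ Fin 4
abbrev FnCode (t : ℕ) := Fin t ⊕ Bool

def evVal (Y x₀ : ℝ) {t : ℕ} (c : Fin t → ℝ × ℝ) : EvCode t → ℝ
  | .inl (i, j, k) => if k = 0 then endL Y (c i) else if k = 1 then endR Y (c i) else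
      crossX Y (c i) (c j)
  | .inr k => x₀ - 1 + k.1

def fnVal (Y : ℝ) {t : ℕ} (c : Fin t → ℝ × ℝ) : FnCode t → ℝ → ℝ
  | .inl i => f Y (c i)
  | .inr false => fun _ => Y
  | .inr true => fun _ => Y + 3

def vert (Y x₀ : ℝ) {t : ℕ} (c : Fin t → ℝ × ℝ) (e : EvCode t × FnCode t) : ℝ × ℝ :=
  (evVal Y x₀ c e.1, fnVal Y c e.2 (evVal Y x₀ c e.1))

lemma g_le_one {Y : ℝ} {q : ℝ × ℝ} (hq : q.2 ≤ Y) (x : ℝ) : g q x ≤ Y + 1 := by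
  unfold g
  have : Real.sqrt (1 - (x - q.1)^2) ≤ 1 := by
    rw [Real.sqrt_le_one]; nlinarith [sq_nonneg (x - q.1)]
  linarith

lemma f_le_one {Y : ℝ} {q : ℝ × ℝ} (hq : q.2 ≤ Y) (x : ℝ) : f Y q x ≤ Y + 1 :=
  max_le (by linarith) (g_le_one hq x)

structure Slab (Y : ℝ) {t : ℕ} (c : Fin t → ℝ × ℝ) (q : ℝ × ℝ) (u v : ℝ) (A B : ℝ → ℝ) : Prop where
  hu : u ≤ q.1
  hv : q.1 ≤ v
  hw : v - u ≤ 1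
  Aq : q.2 ≤ A q.1
  Bq : B q.1 ≤ q.2
  up : ∀ i, q.2 ≤ f Y (c i) q.1 → A u ≤ f Y (c i) u ∧ A v ≤ f Y (c i) v
  dn : ∀ i, f Y (c i) q.1 ≤ q.2 → f Y (c i) u ≤ B u ∧ f Y (c i) v ≤ B v
  BA : B u ≤ A u ∧ B v ≤ A v
  dich : ∀ i, (∀ x ∈ Set.Icc u v, f Y (c i) x = Y) ∨ (∀ x ∈ Set.Icc u v, Y ≤ g (c i) x)
  Aty : (∀ x ∈ Set.Icc u v, A x = Y) ∨ (A = fun _ => Y + 3) ∨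
    ∃ i, A = f Y (c i) ∧ ∀ x ∈ Set.Icc u v, Y ≤ g (c i) x
  Bty : (∀ x ∈ Set.Icc u v, B x = Y) ∨ (B = fun _ => Y + 3) ∨
    ∃ i, B = f Y (c i) ∧ ∀ x ∈ Set.Icc u v, Y ≤ g (c i) x

lemma exists_slab {Y x₀ : ℝ} {t : ℕ} (c : Fin t → ℝ × ℝ) (hc : ∀ i, (c i).2 ≤ Y) (q : ℝ × ℝ)
    (h1 : x₀ - 1 ≤ q.1) (h2 : q.1 ≤ x₀ + 2) (h3 : Y ≤ q.2) (h4 : q.2 ≤ Y + 3) :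
    ∃ (eu ev : EvCode t) (a b : FnCode t), x₀ - 1 ≤ evVal Y x₀ c eu ∧ evVal Y x₀ c eu ≤ x₀ + 2 ∧
      x₀ - 1 ≤ evVal Y x₀ c ev ∧ evVal Y x₀ c ev ≤ x₀ + 2 ∧
      Slab Y c q (evVal Y x₀ c eu) (evVal Y x₀ c ev) (fnVal Y c a) (fnVal Y c b) := by
  set E := evVal Y x₀ c with hE
  set F := fnVal Y c with hF
  have hE0 : E (.inr 0) = x₀ - 1 := by simp [hE, evVal]
  have hE1 : E (.inr 1) = x₀ := by simp [hE, evVal]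
  have hE2 : E (.inr 2) = x₀ + 1 := by simp [hE, evVal]; ring
  have hE3 : E (.inr 3) = x₀ + 2 := by simp [hE, evVal]; ring
  obtain ⟨eu, heu, heumax⟩ := Finset.exists_max_image (Finset.univ.filter (fun e => E e ≤ q.1)) E
    ⟨.inr 0, by simp [hE0]; linarith⟩
  obtain ⟨ev, hev, hevmin⟩ := Finset.exists_min_image (Finset.univ.filter (fun e => q.1 ≤ E e)) E
    ⟨.inr 3, by simp [hE3]; linarith⟩
  simp only [Finset.mem_filter, Finset.mem_univ, true_and] at heu heumax hev hevmin
  have hfree : ∀ e, ¬ (E eu < E e ∧ E e < E ev) := by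
    rintro e ⟨h5, h6⟩
    rcases le_total (E e) q.1 with h | h
    · linarith [heumax e h]
    · linarith [hevmin e h]
  have hw : E ev - E eu ≤ 1 := by
    rcases le_total q.1 x₀ with h | h
    · have := heumax _ (hE0.trans_le h1); have := hevmin _ (h.trans_eq hE1.symm); linarith
    · rcases le_total q.1 (x₀ + 1) with h' | h'
      · have := heumax _ (hE1.trans_le h); have := hevmin _ (h'.trans_eq hE2.symm); linarith
      · have := heumax _ (hE2.trans_le h'); have := hevmin _ (h2.trans_eq hE3.symm); linarith
  have hcase : (E eu < q.1 ∧ q.1 < E ev) ∨ (E eu = q.1 ∧ E ev = q.1) := by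
    rcases heu.lt_or_eq with h | h
    · rcases hev.lt_or_eq with h' | h'
      · exact Or.inl ⟨h, h'⟩
      · exact absurd (heumax ev h'.symm.le) (by linarith)
    · right; exact ⟨h, le_antisymm (h ▸ hevmin eu h.symm.le) hev⟩
  have hFc : ∀ k, Continuous (F k) := by
    rintro (i | _ | _)
    · exact f_cont _ _
    · exact continuous_const
    · exact continuous_const
  have hgap : ∀ i j, ∀ x ∈ Ev Y (c i) (c j), ¬ (E eu < x ∧ x < E ev) := by
    intro i j x hx
    simp only [Ev, Finset.mem_insert, Finset.mem_singleton] at hx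
    rcases hx with rfl | rfl | rfl | rfl | rfl
    · exact hfree (.inl (i, j, 0))
    · simpa [hE, evVal] using hfree (.inl (i, j, 1))
    · exact hfree (.inl (j, j, 0))
    · simpa [hE, evVal] using hfree (.inl (j, j, 1))
    · simpa [hE, evVal] using hfree (.inl (i, j, 2))
  have hends : ∀ i, (∀ x, E eu < x → x < E ev → Y < f Y (c i) x) ∨
      (∀ x, E eu < x → x < E ev → f Y (c i) x = Y) := fun i =>
    end_const (hc i) (hgap i i _ (by simp [Ev])) (hgap i i _ (by simp [Ev]))
  -- three-way order on the open slab
  have htri : ∀ k l, (∀ x, E eu < x → x < E ev → F k x < F l x) ∨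
      (∀ x, E eu < x → x < E ev → F l x < F k x) ∨ (∀ x, E eu < x → x < E ev → F k x = F l x) := by
    have hlt : ∀ i x, f Y (c i) x < Y + 3 := fun i x => by linarith [f_le_one (hc i) x]
    rintro (i | _ | _) (j | _ | _)
    · exact order_const (hc i) (hc j) (hgap i j)
    · rcases hends i with h | h
      · exact Or.inr (Or.inl h)
      · exact Or.inr (Or.inr h)
    · exact Or.inl fun x _ _ => hlt i x
    · rcases hends j with h | h
      · exact Or.inl h
      · exact Or.inr (Or.inr fun x h1 h2 => (h x h1 h2).symm)
    · exact Or.inr (Or.inr fun x _ _ => rfl)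
    · exact Or.inl fun x _ _ => by simp [hF, fnVal]
    · exact Or.inr (Or.inl fun x _ _ => hlt j x)
    · exact Or.inr (Or.inl fun x _ _ => by simp [hF, fnVal])
    · exact Or.inr (Or.inr fun x _ _ => rfl)
  have hmono : ∀ k l, F k q.1 ≤ F l q.1 → F k (E eu) ≤ F l (E eu) ∧ F k (E ev) ≤ F l (E ev) := by
    intro k l hkl
    rcases hcase with ⟨h, h'⟩ | ⟨h, h'⟩
    · have hall : ∀ x, E eu < x → x < E ev → F k x ≤ F l x := by
        rcases htri k l with h5 | h5 | h5
        · exact fun x hx hx' => (h5 x hx hx').le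
        · exact absurd (h5 q.1 h h') (by linarith)
        · exact fun x hx hx' => (h5 x hx hx').le
      have := le_Icc_of_Ioo (hFc k) (hFc l) (h.trans h') hall
      exact ⟨this _ ⟨le_rfl, by linarith⟩, this _ ⟨by linarith, le_rfl⟩⟩
    · rw [h, h']; exact ⟨hkl, hkl⟩
  have hdich : ∀ i, (∀ x ∈ Set.Icc (E eu) (E ev), f Y (c i) x = Y) ∨
      (∀ x ∈ Set.Icc (E eu) (E ev), Y ≤ g (c i) x) := by
    intro i
    rcases hcase with ⟨h, h'⟩ | ⟨h, h'⟩
    · rcases hends i with h5 | h5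
      · right
        refine le_Icc_of_Ioo continuous_const (g_cont _) (h.trans h') fun x hx hx' => ?_
        have := h5 x hx hx'
        rw [f_eq_g this] at this; exact this.le
      · left
        intro x hx
        exact le_antisymm (le_Icc_of_Ioo (f_cont _ _) continuous_const (h.trans h')
          (fun x hx hx' => (h5 x hx hx').le) x hx) (f_ge _ _ _)
    · rw [h, h']
      rcases le_total Y (g (c i) q.1) with h5 | h5
      · right; intro x hx; rw [Set.Icc_self] at hx; rw [hx]; exact h5
      · left; intro x hx; rw [Set.Icc_self] at hx; rw [hx]; exact max_eq_left h5
  have hty : ∀ k, (∀ x ∈ Set.Icc (E eu) (E ev), F k x = Y) ∨ (F k = fun _ => Y + 3) ∨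
    ∃ i, F k = f Y (c i) ∧ ∀ x ∈ Set.Icc (E eu) (E ev), Y ≤ g (c i) x := by
    rintro (i | _ | _)
    · rcases hdich i with h | h
      · exact Or.inl h
      · exact Or.inr (Or.inr ⟨i, rfl, h⟩)
    · exact Or.inl fun _ _ => rfl
    · exact Or.inr (Or.inl rfl)
  obtain ⟨a, ha, hamin⟩ := Finset.exists_min_image (Finset.univ.filter (fun k => q.2 ≤ F k q.1))
    (fun k => F k q.1) ⟨.inr true, by simp [hF, fnVal]; linarith⟩
  obtain ⟨b, hb, hbmax⟩ := Finset.exists_max_image (Finset.univ.filter (fun k => F k q.1 ≤ q.2))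
    (fun k => F k q.1) ⟨.inr false, by simp [hF, fnVal]; linarith⟩
  simp only [Finset.mem_filter, Finset.mem_univ, true_and] at ha hamin hb hbmax
  have hu0 := heumax _ (hE0.trans_le h1)
  have hv0 := hevmin _ (h2.trans_eq hE3.symm)
  refine ⟨eu, ev, a, b, by linarith, by linarith, by linarith, by linarith, heu, hev, hw, ha, hb, ?_, ?_, hmono b a (hb.trans ha), hdich, hty a, hty b⟩
  · intro i hi
    exact hmono a (.inl i) (hamin (.inl i) hi)
  · intro i hi
    exact hmono (.inl i) b (hbmax (.inl i) hi)

/-- no net circle strictly separates slab vertices -/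
lemma slab_not_mixed {Y : ℝ} {t : ℕ} {c : Fin t → ℝ × ℝ} {q : ℝ × ℝ} {u v : ℝ}
    {A B : ℝ → ℝ} (h : Slab Y c q u v A B) (hAY : ∀ x, Y ≤ A x) (hBY : ∀ x, Y ≤ B x) (i : Fin t)
    {k k' : ℝ × ℝ} (hk : k ∈ ({(u, A u), (v, A v), (u, B u), (v, B v)} : Set (ℝ × ℝ)))
    (hk' : k' ∈ ({(u, A u), (v, A v), (u, B u), (v, B v)} : Set (ℝ × ℝ))) :
    ¬ (k.2 < g (c i) k.1 ∧ g (c i) k'.1 < k'.2) := by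
  rintro ⟨h1, h2⟩
  have huv : u ≤ v := h.hu.trans h.hv
  have hkx : ∀ k ∈ ({(u, A u), (v, A v), (u, B u), (v, B v)} : Set (ℝ × ℝ)),
      k.1 ∈ Set.Icc u v ∧ Y ≤ k.2 := by
    rintro k (rfl | rfl | rfl | rfl)
    · exact ⟨⟨le_rfl, huv⟩, hAY _⟩
    · exact ⟨⟨huv, le_rfl⟩, hAY _⟩
    · exact ⟨⟨le_rfl, huv⟩, hBY _⟩
    · exact ⟨⟨huv, le_rfl⟩, hBY _⟩
  have hg : ∀ x ∈ Set.Icc u v, Y ≤ g (c i) x := by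
    rcases h.dich i with h5 | h5
    · exfalso
      have h6 := hkx k hk
      have := h5 _ h6.1
      have := g_le_f Y (c i) k.1
      linarith [h6.2]
    · exact h5
  have hfg : ∀ x ∈ Set.Icc u v, f Y (c i) x = g (c i) x := fun x hx => max_eq_right (hg x hx)
  have hu := hfg u ⟨le_rfl, huv⟩
  have hv := hfg v ⟨huv, le_rfl⟩
  rcases le_total q.2 (f Y (c i) q.1) with h5 | h5
  · have h6 := h.up i h5
    have h7 := h.BA
    rw [hu, hv] at h6
    rcases hk' with rfl | rfl | rfl | rfl <;> simp only at h2 <;> linarith [h6.1, h6.2, h7.1, h7.2]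
  · have h6 := h.dn i h5
    have h7 := h.BA
    rw [hu, hv] at h6
    rcases hk with rfl | rfl | rfl | rfl <;> simp only at h1 <;> linarith [h6.1, h6.2, h7.1, h7.2]

lemma dom_of_le {Y : ℝ} {q : ℝ × ℝ} {x : ℝ} (hq : q.2 < Y) (h : Y ≤ g q x) :
    q.1 - 1 < x ∧ x < q.1 + 1 := by
  refine abs_dom ?_
  exact dom_of_lt (Y := (q.2)) le_rfl (by linarith)

/-- bracketing: a curve through `q` passes weakly above and weakly below slab vertices -/
lemma slab_bracket {Y : ℝ} {t : ℕ} {c : Fin t → ℝ × ℝ} (hc : ∀ i, (c i).2 < Y) {q : ℝ × ℝ} {u v : ℝ}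
    {A B : ℝ → ℝ} (h : Slab Y c q u v A B) (hAY : ∀ x, Y ≤ A x) {z : ℝ × ℝ}
    (hz1 : z.2 < Y) (hz2 : Y - 78/100 ≤ z.2) (hqY : Y ≤ q.2) (hzq : q.2 = g z q.1) :
    (g z u ≤ A u ∨ g z v ≤ A v) ∧ (B u ≤ g z u ∨ B v ≤ g z v) := by
  have huv : u ≤ v := h.hu.trans h.hv
  have hq := dom_of_le hz1 (hqY.trans_eq hzq)
  have hqm : q.1 ∈ Set.Icc u v := ⟨h.hu, h.hv⟩
  have hum : u ∈ Set.Icc u v := ⟨le_rfl, huv⟩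
  have hvm : v ∈ Set.Icc u v := ⟨huv, le_rfl⟩
  constructor
  · by_contra hcon
    push Not at hcon
    obtain ⟨h1, h2⟩ := hcon
    have h3 : Y < g z u := (hAY u).trans_lt h1
    have h4 : Y < g z v := (hAY v).trans_lt h2
    rcases h.Aty with h5 | h5 | ⟨i, h5, h6⟩
    · have h7 := (f_gt_iff hz1.le u).1 (h3.trans_le (g_le_f _ _ _))
      have h8 := (f_gt_iff hz1.le v).1 (h4.trans_le (g_le_f _ _ _))
      have h9 := (f_gt_iff hz1.le q.1).2 ⟨by linarith [h.hu], by linarith [h.hv]⟩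
      rw [f_eq_g h9] at h9
      have := h.Aq
      rw [h5 _ hqm] at this
      linarith
    · rw [h5] at h1
      linarith [g_le_one hz1.le u]
    · have hA : ∀ x ∈ Set.Icc u v, A x = g (c i) x := fun x hx => by
        rw [h5]; exact max_eq_right (h6 x hx)
      rw [hA u hum] at h1
      rw [hA v hvm] at h2
      have h9 := h.Aq
      rw [hA _ hqm, hzq] at h9
      have d1 := dom_of_le (hc i) (h6 u hum)
      have d2 := dom_of_le (hc i) (h6 v hvm)
      have d3 := dom_of_le hz1 h3.le
      have d4 := dom_of_le hz1 h4.le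
      exact no_V h.hu h.hv (by linarith) (by linarith) (by linarith) (by linarith) h1 h9 h2
  · by_contra hcon
    push Not at hcon
    obtain ⟨h1, h2⟩ := hcon
    rcases h.Bty with h5 | h5 | ⟨i, h5, h6⟩
    · rw [h5 u hum] at h1
      rw [h5 v hvm] at h2
      have key : ∀ x, g z x < Y → 1 - (Y - z.2)^2 < (x - z.1)^2 := by
        intro x hx
        unfold g at hx
        by_contra hle
        push Not at hle
        have : Y - z.2 ≤ Real.sqrt (1 - (x - z.1)^2) := by
          apply Real.le_sqrt_of_sq_le; linarith
        linarith
      have k1 := key u h1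
      have k2 := key v h2
      have k3 : (q.1 - z.1)^2 ≤ 1 - (Y - z.2)^2 := by
        have h7 : Y - z.2 ≤ Real.sqrt (1 - (q.1 - z.1)^2) := by unfold g at hzq; linarith
        have h8 : 0 ≤ 1 - (q.1 - z.1)^2 := by nlinarith
        have := Real.sq_sqrt h8
        nlinarith
      have k4 : (39:ℝ)/100 ≤ 1 - (Y - z.2)^2 := by nlinarith
      have l1 : u - z.1 < -(6/10) := by
        by_contra hle; push Not at hle
        have : u - z.1 ≤ q.1 - z.1 := by linarith [h.hu]
        rcases le_total 0 (u - z.1) with h9 | h9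
        · nlinarith
        · nlinarith
      have l2 : 6/10 < v - z.1 := by
        by_contra hle; push Not at hle
        have : q.1 - z.1 ≤ v - z.1 := by linarith [h.hv]
        rcases le_total 0 (v - z.1) with h9 | h9
        · nlinarith
        · nlinarith
      linarith [h.hw]
    · have := h.Bq
      rw [h5, hzq] at this
      linarith [g_le_one hz1.le q.1]
    · have hB : ∀ x ∈ Set.Icc u v, B x = g (c i) x := fun x hx => by
        rw [h5]; exact max_eq_right (h6 x hx)
      rw [hB u hum] at h1
      rw [hB v hvm] at h2
      have h9 := h.Bq
      rw [hB _ hqm, hzq] at h9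
      have d1 := dom_of_le (hc i) (h6 u hum)
      have d2 := dom_of_le (hc i) (h6 v hvm)
      have gend : ∀ x, (x - z.1)^2 = 1 → g z x = z.2 := by
        intro x hx; unfold g; rw [hx]; simp
      have hU : ∃ u', u ≤ u' ∧ u' ≤ q.1 ∧ z.1 - 1 ≤ u' ∧ g z u' < g (c i) u' := by
        rcases le_total (z.1 - 1) u with h' | h'
        · exact ⟨u, le_rfl, h.hu, h', h1⟩
        · refine ⟨z.1 - 1, h', by linarith, le_rfl, ?_⟩
          rw [gend _ (by ring)]
          linarith [h6 (z.1 - 1) ⟨h', by linarith [h.hv]⟩]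
      have hV : ∃ v', v' ≤ v ∧ q.1 ≤ v' ∧ v' ≤ z.1 + 1 ∧ g z v' < g (c i) v' := by
        rcases le_total v (z.1 + 1) with h' | h'
        · exact ⟨v, le_rfl, h.hv, h', h2⟩
        · refine ⟨z.1 + 1, h', by linarith, le_rfl, ?_⟩
          rw [gend _ (by ring)]
          linarith [h6 (z.1 + 1) ⟨by linarith [h.hu], h'⟩]
      obtain ⟨u', a1, a2, a3, a4⟩ := hU
      obtain ⟨v', b1, b2, b3, b4⟩ := hV
      exact no_V a2 b2 a3 b3 (by linarith) (by linarith) a4 h9 b4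
end PT

namespace PT

/-- reflection -/
def rf (p : ℝ × ℝ) : ℝ × ℝ := (p.1, -p.2)

/-- signed vertical position of `p` relative to the arc of `v` -/
def S (p v : ℝ × ℝ) : ℝ := p.2 - v.2 - Real.sqrt (1 - (p.1 - v.1)^2)

lemma rf_rf (p : ℝ × ℝ) : rf (rf p) = p := by simp [rf]

lemma S_rf (p v : ℝ × ℝ) : S p v = (rf v).2 - g (rf p) (rf v).1 := by
  unfold S g rf
  simp only
  rw [show (p.1 - v.1)^2 = (v.1 - p.1)^2 by ring]
  ring

lemma S_rf' (p k : ℝ × ℝ) : S p (rf k) = k.2 - g (rf p) k.1 := by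
  rw [S_rf, rf_rf]

lemma S_g (p v : ℝ × ℝ) : S p v = p.2 - g v p.1 := by unfold S g; ring

def evIdx {t : ℕ} : EvCode t → Finset (Fin t)
  | .inl (i, j, _) => {i, j}
  | .inr _ => ∅

def fnIdx {t : ℕ} : FnCode t → Finset (Fin t)
  | .inl i => {i}
  | .inr _ => ∅

lemma evIdx_card {t : ℕ} (e : EvCode t) : (evIdx e).card ≤ 2 := by
  rcases e with ⟨i, j, k⟩ | k
  · exact Finset.card_le_two
  · simp [evIdx]

lemma fnIdx_card {t : ℕ} (e : FnCode t) : (fnIdx e).card ≤ 1 := by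
  rcases e with i | k
  · simp [fnIdx]
  · simp [fnIdx]

lemma evVal_loc {Y x₀ : ℝ} {t : ℕ} {c c' : Fin t → ℝ × ℝ} (e : EvCode t)
    (h : ∀ i ∈ evIdx e, c i = c' i) : evVal Y x₀ c e = evVal Y x₀ c' e := by
  rcases e with ⟨i, j, k⟩ | k
  · simp only [evVal]
    rw [h i (by simp [evIdx]), h j (by simp [evIdx])]
  · rfl

lemma fnVal_loc {Y : ℝ} {t : ℕ} {c c' : Fin t → ℝ × ℝ} (e : FnCode t)
    (h : ∀ i ∈ fnIdx e, c i = c' i) : fnVal Y c e = fnVal Y c' e := by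
  rcases e with i | _ | _
  · simp only [fnVal]
    rw [h i (by simp [fnIdx])]
  · rfl
  · rfl

lemma vert_loc {Y x₀ : ℝ} {t : ℕ} {c c' : Fin t → ℝ × ℝ} (e : EvCode t × FnCode t)
    (h : ∀ i ∈ evIdx e.1 ∪ fnIdx e.2, c i = c' i) : vert Y x₀ c e = vert Y x₀ c' e := by
  unfold vert
  rw [evVal_loc e.1 (fun i hi => h i (Finset.mem_union_left _ hi)),
    fnVal_loc e.2 (fun i hi => h i (Finset.mem_union_right _ hi))]

lemma fnVal_ge (Y : ℝ) {t : ℕ} (c : Fin t → ℝ × ℝ) (k : FnCode t) (x : ℝ) : Y ≤ fnVal Y c k x := by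
  rcases k with i | _ | _
  · exact f_ge _ _ _
  · exact le_rfl
  · simp [fnVal]

lemma fnVal_le {Y : ℝ} {t : ℕ} {c : Fin t → ℝ × ℝ} (hc : ∀ i, (c i).2 ≤ Y) (k : FnCode t) (x : ℝ) :
    fnVal Y c k x ≤ Y + 3 := by
  rcases k with i | _ | _
  · have := f_le_one (hc i) x
    simp only [fnVal]; linarith
  · simp [fnVal]
  · simp [fnVal]

def nv (t : ℕ) : ℕ := (3 * t^2 + 4) * (t + 2)

lemma card_code (t : ℕ) : Fintype.card (EvCode t × FnCode t) = nv t := by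
  simp [nv, EvCode, FnCode]
  ring

lemma test_set (Y x₀ : ℝ) {ι : Type*} [Fintype ι] [Nonempty ι] (ps : ι → ℝ × ℝ)
    (hps : ∀ i, Y < (ps i).2) (t : ℕ) (ht : 6 ≤ t) (ε : ℝ) (hε : 0 ≤ ε) (hε1 : ε ≤ 1)
    (hD : ((nv t : ℝ)^2) * (1-ε)^(t-6) < 1) :
    ∃ Q : Finset (ℝ × ℝ), Q.Nonempty ∧ Q.card ≤ nv t ∧
      (∀ v ∈ Q, x₀ - 1 ≤ v.1 ∧ v.1 ≤ x₀ + 2 ∧ Y - 3 ≤ v.2 ∧ v.2 ≤ Y) ∧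
      ∀ q : ℝ × ℝ, x₀ - 1 ≤ q.1 → q.1 ≤ x₀ + 2 → Y - 3 ≤ q.2 → q.2 ≤ Y →
      ∃ H ⊆ Q, H.card ≤ 4 ∧
        ((Finset.univ.filter (fun i => (∃ h ∈ H, S (ps i) h < 0) ∧ ∃ h ∈ H, 0 < S (ps i) h)).card : ℝ)
          ≤ 16 * (ε * Fintype.card ι) ∧
        ∀ z : ℝ × ℝ, Y < z.2 → z.2 ≤ Y + 78/100 → S z q = 0 →
          (∃ h ∈ H, S z h ≤ 0) ∧ ∃ h ∈ H, 0 ≤ S z h := by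
  set V : (Fin t → ι) → EvCode t × FnCode t → ℝ × ℝ := fun N e =>
    vert (-Y) x₀ (fun i => rf (ps (N i))) e with hV
  set Bad : (EvCode t × FnCode t) × (EvCode t × FnCode t) → (Fin t → ι) → Finset ι := fun d N =>
    Finset.univ.filter (fun i => S (ps i) (rf (V N d.1)) < 0 ∧ 0 < S (ps i) (rf (V N d.2))) with hBad
  obtain ⟨N, hN⟩ := net_lemma (fun d => (evIdx d.1.1 ∪ fnIdx d.1.2) ∪ (evIdx d.2.1 ∪ fnIdx d.2.2))
    Bad (by
      intro d N N' h
      have e1 : V N d.1 = V N' d.1 := vert_loc d.1 fun i hi => by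
        rw [h i (Finset.mem_union_left _ hi)]
      have e2 : V N d.2 = V N' d.2 := vert_loc d.2 fun i hi => by
        rw [h i (Finset.mem_union_right _ hi)]
      simp only [hBad, e1, e2]) ε hε hε1 (by
      intro d
      have h1 := Finset.card_union_le (evIdx d.1.1 ∪ fnIdx d.1.2) (evIdx d.2.1 ∪ fnIdx d.2.2)
      have h2 := Finset.card_union_le (evIdx d.1.1) (fnIdx d.1.2)
      have h3 := Finset.card_union_le (evIdx d.2.1) (fnIdx d.2.2)
      have := evIdx_card d.1.1
      have := evIdx_card d.2.1
      have := fnIdx_card d.1.2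
      have := fnIdx_card d.2.2
      omega) ht (by
      rw [Fintype.card_prod, card_code]
      push_cast
      rw [← pow_two]; exact hD)
  set c : Fin t → ℝ × ℝ := fun i => rf (ps (N i)) with hc
  have hcY : ∀ i, (c i).2 < -Y := fun i => by simp [hc, rf]; exact hps _
  set Q : Finset (ℝ × ℝ) := (Finset.univ.image (fun e => rf (V N e))).filter
    (fun v => x₀ - 1 ≤ v.1 ∧ v.1 ≤ x₀ + 2 ∧ Y - 3 ≤ v.2 ∧ v.2 ≤ Y) with hQ
  have hmemQ : ∀ e : EvCode t × FnCode t, x₀ - 1 ≤ evVal (-Y) x₀ c e.1 → evVal (-Y) x₀ c e.1 ≤ x₀ + 2 →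
      rf (V N e) ∈ Q := by
    intro e h1 h2
    rw [hQ, Finset.mem_filter]
    refine ⟨Finset.mem_image_of_mem _ (Finset.mem_univ _), h1, h2, ?_, ?_⟩
    · have := fnVal_le (fun i => (hcY i).le) e.2 (evVal (-Y) x₀ c e.1)
      show Y - 3 ≤ -(fnVal (-Y) c e.2 (evVal (-Y) x₀ c e.1)); linarith
    · have := fnVal_ge (-Y) c e.2 (evVal (-Y) x₀ c e.1)
      show -(fnVal (-Y) c e.2 (evVal (-Y) x₀ c e.1)) ≤ Y; linarith
  refine ⟨Q, ⟨_, hmemQ (.inr 1, .inr false) (by simp [evVal]) (by simp [evVal])⟩, ?_, ?_, ?_⟩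
  · refine (Finset.card_filter_le _ _).trans (Finset.card_image_le.trans ?_)
    rw [Finset.card_univ, card_code]
  · intro v hv
    rw [hQ, Finset.mem_filter] at hv
    exact hv.2
  intro q h1 h2 h3 h4
  obtain ⟨eu, ev, a, b, l1, l2, l3, l4, hslab⟩ := exists_slab c (fun i => (hcY i).le) (rf q)
    h1 h2 (by simp [rf]; exact h4) (by simp [rf]; linarith)
  set u := evVal (-Y) x₀ c eu with hu
  set v := evVal (-Y) x₀ c ev with hv
  set A := fnVal (-Y) c a with hA
  set B := fnVal (-Y) c b with hB
  set HC : Finset (EvCode t × FnCode t) := {(eu, a), (ev, a), (eu, b), (ev, b)} with hHC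
  have hHCv : ∀ e ∈ HC, V N e ∈ ({(u, A u), (v, A v), (u, B u), (v, B v)} : Set (ℝ × ℝ)) := by
    intro e he
    simp only [hHC, Finset.mem_insert, Finset.mem_singleton] at he
    rcases he with rfl | rfl | rfl | rfl
    · left; rfl
    · right; left; rfl
    · right; right; left; rfl
    · right; right; right; rfl
  refine ⟨HC.image (fun e => rf (V N e)), ?_, Finset.card_image_le.trans Finset.card_le_four, ?_, ?_⟩
  · intro w hw
    rw [Finset.mem_image] at hw
    obtain ⟨e, he, rfl⟩ := hw
    simp only [hHC, Finset.mem_insert, Finset.mem_singleton] at he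
    rcases he with rfl | rfl | rfl | rfl
    · exact hmemQ _ l1 l2
    · exact hmemQ _ l3 l4
    · exact hmemQ _ l1 l2
    · exact hmemQ _ l3 l4
  · have hsub : (Finset.univ.filter (fun i => (∃ h ∈ HC.image (fun e => rf (V N e)), S (ps i) h < 0) ∧
        ∃ h ∈ HC.image (fun e => rf (V N e)), 0 < S (ps i) h)) ⊆
        (HC ×ˢ HC).biUnion (fun d => Bad d N) := by
      intro i hi
      simp only [Finset.mem_filter, Finset.mem_univ, true_and, Finset.exists_mem_image] at hi
      obtain ⟨⟨e, he, he'⟩, ⟨e2, he2, he2'⟩⟩ := hi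
      rw [Finset.mem_biUnion]
      exact ⟨(e, e2), Finset.mem_product.2 ⟨he, he2⟩, by simp [hBad, he', he2']⟩
    have hbad : ∀ d ∈ HC ×ˢ HC, ((Bad d N).card : ℝ) ≤ ε * Fintype.card ι := by
      intro d hd
      rw [Finset.mem_product] at hd
      apply hN
      intro i hi
      simp only [hBad, Finset.mem_filter, Finset.mem_univ, true_and, S_rf'] at hi
      refine slab_not_mixed hslab (fnVal_ge _ _ _) (fnVal_ge _ _ _) i (hHCv _ hd.1) (hHCv _ hd.2) ⟨?_, ?_⟩
      · simp only [hc]; linarith [hi.1]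
      · simp only [hc]; linarith [hi.2]
    have h5 := (Finset.card_le_card hsub).trans Finset.card_biUnion_le
    have h6 := (Nat.cast_le (α := ℝ)).2 h5
    push_cast at h6
    refine h6.trans ((Finset.sum_le_card_nsmul _ _ _ hbad).trans ?_)
    rw [nsmul_eq_mul]
    refine mul_le_mul_of_nonneg_right ?_ (by positivity)
    have : HC.card ≤ 4 := Finset.card_le_four
    have h7 : (HC ×ˢ HC).card ≤ 16 := by rw [Finset.card_product]; nlinarith
    exact_mod_cast h7
  · intro z hz1 hz2 hz3
    rw [S_rf] at hz3
    have hbr := slab_bracket hcY hslab (fnVal_ge _ _ _) (z := rf z) (by simp [rf]; exact hz1)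
      (by simp only [rf]; linarith) (by simp [rf]; exact h4) (by linarith)
    simp only [Finset.exists_mem_image, S_rf']
    constructor
    · rcases hbr.2 with h | h
      · exact ⟨(eu, b), by simp [hHC], by show B u - g (rf z) u ≤ 0; linarith⟩
      · exact ⟨(ev, b), by simp [hHC], by show B v - g (rf z) v ≤ 0; linarith⟩
    · rcases hbr.1 with h | h
      · exact ⟨(eu, a), by simp [hHC], by show 0 ≤ A u - g (rf z) u; linarith⟩
      · exact ⟨(ev, a), by simp [hHC], by show 0 ≤ A v - g (rf z) v; linarith⟩
end PT

namespace PT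

lemma params : ∃ ρ₀ : ℕ, 4 ≤ ρ₀ ∧ ∀ ρ : ℕ, ρ₀ ≤ ρ → nv (ρ^3) ≤ 2^ρ ∧ 6 ≤ ρ^3 ∧
    ((nv (ρ^3) : ℕ) : ℝ)^2 * (1 - 1/(ρ:ℝ))^(ρ^3 - 6) < 1 := by
  have ht := tendsto_pow_const_div_const_pow_of_one_lt 9 (show (1:ℝ) < 2 by norm_num)
  have h1 := (ht.eventually (gt_mem_nhds (show (0:ℝ) < 1/21 by norm_num)))
  obtain ⟨N, hN⟩ := Filter.eventually_atTop.mp h1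
  refine ⟨max N 4, le_max_right _ _, ?_⟩
  intro ρ hρ
  have hρN : N ≤ ρ := (le_max_left _ _).trans hρ
  have hρ4 : 4 ≤ ρ := (le_max_right _ _).trans hρ
  have h2 := hN ρ hρN
  have h3 : nv (ρ^3) ≤ 2^ρ := by
    have h4 : (21:ℝ) * (ρ:ℝ)^9 ≤ 2^ρ := by
      rw [div_lt_iff₀ (by positivity)] at h2
      linarith
    have h5 : 21 * ρ^9 ≤ 2^ρ := by exact_mod_cast h4
    refine le_trans ?_ h5
    unfold nv
    have a1 : 1 ≤ ρ^3 := Nat.one_le_pow _ _ (by omega)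
    generalize hr : ρ^3 = r at a1
    have : ρ^9 = r^3 := by rw [← hr]; ring
    rw [this]
    have b1 : 3 * r^2 + 4 ≤ 7 * r^2 := by nlinarith
    have b2 : r + 2 ≤ 3 * r := by omega
    calc (3 * r^2+4) * (r+2) ≤ (7 * r^2) * (3 * r) := Nat.mul_le_mul b1 b2
      _ = 21 * r^3 := by ring
  have h6 : 6 ≤ ρ^3 := by
    calc 6 ≤ 4^3 := by norm_num
      _ ≤ ρ^3 := Nat.pow_le_pow_left hρ4 3
  refine ⟨h3, h6, ?_⟩
  have r4 : (4:ℝ) ≤ ρ := by exact_mod_cast hρ4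
  have r0 : (0:ℝ) < ρ := by linarith
  have e1 : 0 ≤ 1 - 1/(ρ:ℝ) := by
    rw [sub_nonneg, div_le_one r0]; linarith
  have e2 : 1 - 1/(ρ:ℝ) ≤ Real.exp (-(1/(ρ:ℝ))) := by
    have := Real.add_one_le_exp (-(1/(ρ:ℝ))); linarith
  have e3 : (1 - 1/(ρ:ℝ))^(ρ^3 - 6) ≤ Real.exp (-((ρ:ℝ)^2 - 2)) := by
    refine (pow_le_pow_left₀ e1 e2 _).trans ?_
    rw [← Real.exp_nat_mul, Real.exp_le_exp, Nat.cast_sub h6]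
    push_cast
    have : ((ρ:ℝ)^3 - 6) * -(1/(ρ:ℝ)) = -((ρ:ℝ)^2 - 6/ρ) := by field_simp
    rw [this]
    have : 6/(ρ:ℝ) ≤ 2 := by rw [div_le_iff₀ r0]; linarith
    linarith
  have e4 : ((nv (ρ^3) : ℕ) : ℝ)^2 ≤ Real.exp (2 * ρ) := by
    have : ((nv (ρ^3) : ℕ) : ℝ) ≤ Real.exp ρ := by
      calc ((nv (ρ^3) : ℕ) : ℝ) ≤ (2:ℝ)^ρ := by exact_mod_cast h3
        _ ≤ (Real.exp 1)^ρ := by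
          gcongr
          have := Real.add_one_le_exp (1:ℝ); linarith
        _ = Real.exp ρ := by rw [← Real.exp_nat_mul]; simp
    calc _ ≤ (Real.exp ρ)^2 := by gcongr
      _ = _ := by rw [← Real.exp_nat_mul]; simp
  calc _ ≤ Real.exp (2 * ρ) * Real.exp (-((ρ:ℝ)^2 - 2)) := by gcongr
    _ = Real.exp (2 * ρ - ((ρ:ℝ)^2 - 2)) := by rw [← Real.exp_add]; ring_nf
    _ < 1 := by rw [Real.exp_lt_one_iff]; nlinarith

/-- the arc of `q` crosses the (open) cell at a point of the relevant region -/
def Crs (Y x₀ : ℝ) (q : ℝ × ℝ) (δ : Cell) : Prop :=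
  ∃ z : ℝ × ℝ, δ.u < z.1 ∧ z.1 < δ.v ∧ g δ.bot z.1 < z.2 ∧ Y < z.2 ∧ z.2 < g δ.top z.1 ∧
    z.2 ≤ Y + 78/100 ∧ x₀ ≤ z.1 ∧ z.1 ≤ x₀ + 1 ∧ S z q = 0

def Box (Y x₀ : ℝ) (q : ℝ × ℝ) : Prop := x₀ - 1 ≤ q.1 ∧ q.1 ≤ x₀ + 2 ∧ Y - 3 ≤ q.2 ∧ q.2 ≤ Y

lemma Crs.box {Y x₀ : ℝ} {q : ℝ × ℝ} {δ : Cell} (h : Crs Y x₀ q δ) (hq : q.2 ≤ Y) : Box Y x₀ q := by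
  obtain ⟨z, -, -, -, h1, -, -, h2, h3, h4⟩ := h
  rw [S_g] at h4
  have h5 : z.2 = g q z.1 := by linarith
  obtain ⟨a, b⟩ := abs_dom (dom_of_lt hq (h5 ▸ h1))
  have : g q z.1 ≤ q.2 + 1 := g_le_one le_rfl _
  exact ⟨by linarith, by linarith, by linarith, hq⟩

/-- an arc which does not enter an open cell passes below it or above it -/
lemma above_or_below {Y : ℝ} {h : ℝ × ℝ} {δ : Cell} (huv : δ.u < δ.v)
    (hlt : ∀ x, δ.u < x → x < δ.v → f Y δ.bot x < f Y δ.top x) (hc : ¬ Conf Y h δ) :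
    (∀ x ∈ Set.Icc δ.u δ.v, f Y h x ≤ f Y δ.bot x) ∨
    (∀ x ∈ Set.Icc δ.u δ.v, f Y δ.top x ≤ f Y h x) := by
  have hc' : ∀ x, δ.u < x → x < δ.v → f Y h x ≤ f Y δ.bot x ∨ f Y δ.top x ≤ f Y h x := by
    intro x h1 h2
    by_contra hcon
    push Not at hcon
    exact hc ⟨x, h1, h2, hcon.1, hcon.2⟩
  have hs := sign_const (F := fun x => 2 * f Y h x) (G := fun x => f Y δ.bot x + f Y δ.top x)
    (u := δ.u) (v := δ.v)
    (continuous_const.mul (f_cont Y h)) ((f_cont Y _).add (f_cont Y _)) (by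
      intro x h1 h2 he
      have := hlt x h1 h2
      rcases hc' x h1 h2 with h3 | h3 <;> linarith)
  rcases hs with hs | hs
  · left
    refine le_Icc_of_Ioo (f_cont _ _) (f_cont _ _) huv fun x h1 h2 => ?_
    have a := hs x h1 h2
    have := hlt x h1 h2
    rcases hc' x h1 h2 with h3 | h3
    · exact h3
    · linarith
  · right
    refine le_Icc_of_Ioo (f_cont _ _) (f_cont _ _) huv fun x h1 h2 => ?_
    have a := hs x h1 h2
    have := hlt x h1 h2
    rcases hc' x h1 h2 with h3 | h3
    · linarith
    · exact h3

lemma S_nonneg_iff {Y : ℝ} {p h : ℝ × ℝ} (hp : Y ≤ p.2) : 0 ≤ S p h ↔ f Y h p.1 ≤ p.2 := by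
  rw [S_g, f, max_le_iff, sub_nonneg]; tauto

lemma S_nonpos_of {Y : ℝ} {p h : ℝ × ℝ} (hp : Y < p.2) (h1 : p.2 ≤ f Y h p.1) : S p h ≤ 0 := by
  rw [f_eq_g (hp.trans_le h1)] at h1
  rw [S_g]; linarith

lemma S_neg_of {Y : ℝ} {p h : ℝ × ℝ} (hp : Y < p.2) (h1 : p.2 < f Y h p.1) : S p h < 0 := by
  rw [f_eq_g (hp.trans h1)] at h1
  rw [S_g]; linarith

/-- the sign of all points of a cell agrees with the sign of an interior point -/
lemma mixed_of_cross {Y : ℝ} {H : Finset (ℝ × ℝ)} {δ : Cell} (huv : δ.u < δ.v)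
    (hlt : ∀ x, δ.u < x → x < δ.v → f Y δ.bot x < f Y δ.top x)
    (hc : ∀ h ∈ H, ¬ Conf Y h δ) {z : ℝ × ℝ} (hu : δ.u < z.1) (hv : z.1 < δ.v)
    (hz : Y < z.2) (hb : g δ.bot z.1 < z.2) (ht : z.2 < g δ.top z.1)
    (hm1 : ∃ h ∈ H, S z h ≤ 0) (hm2 : ∃ h ∈ H, 0 ≤ S z h)
    {p : ℝ × ℝ} (hp : Y < p.2) (hpc : InCell Y p δ) (hp0 : ∀ h ∈ H, S p h ≠ 0) :
    (∃ h ∈ H, S p h < 0) ∧ ∃ h ∈ H, 0 < S p h := by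
  have hb' : f Y δ.bot z.1 < z.2 := max_lt hz hb
  have ht' : z.2 < f Y δ.top z.1 := ht.trans_le (g_le_f _ _ _)
  have hzI : z.1 ∈ Set.Icc δ.u δ.v := ⟨hu.le, hv.le⟩
  have hpI : p.1 ∈ Set.Icc δ.u δ.v := ⟨hpc.1, hpc.2.1⟩
  constructor
  · obtain ⟨h, hh, h1⟩ := hm1
    refine ⟨h, hh, lt_of_le_of_ne ?_ (hp0 h hh)⟩
    rcases above_or_below huv hlt (hc h hh) with h2 | h2
    · exfalso
      have h3 := (h2 _ hzI).trans_lt hb'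
      have := g_le_f Y h z.1
      rw [S_g] at h1
      linarith
    · exact S_nonpos_of hp (hpc.2.2.2.trans (h2 _ hpI))
  · obtain ⟨h, hh, h1⟩ := hm2
    refine ⟨h, hh, lt_of_le_of_ne ?_ (hp0 h hh).symm⟩
    rcases above_or_below huv hlt (hc h hh) with h2 | h2
    · exact (S_nonneg_iff hp.le).2 ((h2 _ hpI).trans hpc.2.2.1)
    · exfalso
      have := S_neg_of hz (ht'.trans_le (h2 _ hzI))
      linarith

lemma fiber_count {ι : Type*} [Fintype ι] {m : ℕ} (col : ι → Fin m) (s : ℕ)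
    (hs : ∀ i, s ≤ (Finset.univ.filter (fun p => col p = i)).card) (T : Finset (Fin m))
    (M : Finset ι) (hM : ∀ p, col p ∈ T → p ∈ M) : T.card * s ≤ M.card := by
  have h1 := Finset.card_eq_sum_card_fiberwise (f := col)
    (s := Finset.univ.filter (fun p => col p ∈ T)) (t := T) (by intro p hp; simpa using hp)
  have h2 : (Finset.univ.filter (fun p => col p ∈ T)).card ≤ M.card :=
    Finset.card_le_card fun p hp => hM p (by simpa using hp)
  refine le_trans ?_ h2
  rw [h1, ← smul_eq_mul]
  refine Finset.card_nsmul_le_sum _ _ _ fun i hi => (hs i).trans (Finset.card_le_card ?_)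
  intro p hp
  simp only [Finset.mem_filter, Finset.mem_univ, true_and] at hp ⊢
  exact ⟨hp ▸ hi, hp⟩

lemma count_bound {ι : Type*} [Fintype ι] {m : ℕ} {Y x₀ : ℝ} (ps : ι → ℝ × ℝ)
    (hps : ∀ i, Y < (ps i).2) (col : ι → Fin m) (δ : Fin m → Cell)
    (huv : ∀ i, (δ i).u < (δ i).v)
    (hlt : ∀ i x, (δ i).u < x → x < (δ i).v → f Y (δ i).bot x < f Y (δ i).top x)
    (hin : ∀ p, InCell Y (ps p) (δ (col p))) (s : ℕ)
    (hs : ∀ i, s ≤ (Finset.univ.filter (fun p => col p = i)).card)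
    (q : ℝ × ℝ) (H : Finset (ℝ × ℝ)) (hH : H.card ≤ 4) (B : ℕ)
    (hB : ∀ h ∈ H, (Finset.univ.filter (fun i => Conf Y h (δ i))).card ≤ B)
    (hZ : ∀ h ∈ H, (Finset.univ.filter (fun i => S (ps i) h = 0)).card ≤ 2)
    (hbr : ∀ z : ℝ × ℝ, Y < z.2 → z.2 ≤ Y + 78/100 → S z q = 0 →
      (∃ h ∈ H, S z h ≤ 0) ∧ ∃ h ∈ H, 0 ≤ S z h) :
    ∃ c : ℕ, (Finset.univ.filter (fun i => Crs Y x₀ q (δ i))).card ≤ 4 * B + 8 + c ∧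
      c * s ≤ (Finset.univ.filter (fun i => (∃ h ∈ H, S (ps i) h < 0) ∧ ∃ h ∈ H, 0 < S (ps i) h)).card := by
  set A1 := H.biUnion (fun h => Finset.univ.filter (fun i => Conf Y h (δ i))) with hA1
  set A2 := (H.biUnion (fun h => Finset.univ.filter (fun i => S (ps i) h = 0))).image col with hA2
  set A := Finset.univ.filter (fun i => Crs Y x₀ q (δ i)) with hA
  set T := A \ (A1 ∪ A2) with hT
  refine ⟨T.card, ?_, fiber_count col s hs T _ ?_⟩
  · have c1 : A1.card ≤ 4 * B :=
      (Finset.card_biUnion_le_card_mul _ _ B hB).trans (Nat.mul_le_mul_right _ hH)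
    have c2 : A2.card ≤ 8 := by
      refine Finset.card_image_le.trans ((Finset.card_biUnion_le_card_mul _ _ 2 hZ).trans ?_)
      omega
    have c3 : A.card ≤ ((A1 ∪ A2) ∪ T).card := Finset.card_le_card (by
      intro i hi; rw [hT]; simp only [Finset.mem_union, Finset.mem_sdiff]; tauto)
    have c4 := Finset.card_union_le (A1 ∪ A2) T
    have c5 := Finset.card_union_le A1 A2
    omega
  · intro p hp
    simp only [hT, Finset.mem_sdiff, Finset.mem_union, not_or] at hp
    obtain ⟨hp1, hp2, hp3⟩ := hp
    simp only [hA, Finset.mem_filter, Finset.mem_univ, true_and] at hp1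
    obtain ⟨z, z1, z2, z3, z4, z5, z6, z7, z8, z9⟩ := hp1
    obtain ⟨m1, m2⟩ := hbr z z4 z6 z9
    simp only [Finset.mem_filter, Finset.mem_univ, true_and]
    refine mixed_of_cross (huv _) (hlt _) ?_ z1 z2 z4 z3 z5 m1 m2 (hps p) (hin p) ?_
    · intro h hh hc
      exact hp2 (by
        rw [hA1]; simp only [Finset.mem_biUnion, Finset.mem_filter, Finset.mem_univ, true_and]
        exact ⟨h, hh, hc⟩)
    · intro h hh hc
      exact hp3 (by
        rw [hA2]
        refine Finset.mem_image_of_mem _ ?_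
        simp only [Finset.mem_biUnion, Finset.mem_filter, Finset.mem_univ, true_and]
        exact ⟨h, hh, hc⟩)

end PT

namespace PT

lemma setup (Y x₀ : ℝ) (Q : Finset (ℝ × ℝ)) (hQ : ∀ c ∈ Q, Box Y x₀ c) :
    Base Y (x₀, Y - 2) (x₀ + 1/4, Y) Q ∧ (∀ x, x₀ - 1/4 < x → x < x₀ + 1 → Y < f Y (x₀ + 1/4, Y) x) ∧
    (∀ p : ℝ × ℝ, Y ≤ p.2 → p.2 ≤ Y + 3/4 → x₀ ≤ p.1 → p.1 ≤ x₀ + 3/4 →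
      Pos Y (x₀ + 1/4, Y) (x₀ - 1/4) (x₀ + 1) p) := by
  refine ⟨⟨fun c hc => (hQ c hc).2.2.2, by simp, by simp, ?_⟩, ?_, ?_⟩
  · intro x
    unfold f
    refine max_eq_left ?_
    have := g_le_one (Y := Y - 2) (q := (x₀, Y - 2)) le_rfl x
    linarith
  · intro x h1 h2
    refine lt_of_lt_of_le ?_ (g_le_f _ _ _)
    unfold g
    have : 0 < Real.sqrt (1 - (x - (x₀ + 1/4))^2) := Real.sqrt_pos.2 (by nlinarith)
    simpa using this
  · intro p h1 h2 h3 h4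
    refine ⟨h1, by linarith, by linarith, ?_⟩
    refine lt_of_lt_of_le ?_ (g_le_f _ _ _)
    unfold g
    have : (3/4:ℝ) < Real.sqrt (1 - (p.1 - (x₀ + 1/4))^2) := by
      apply Real.lt_sqrt_of_sq_lt
      nlinarith
    simp only
    linarith

structure Good (Y x₀ : ℝ) (δ : Cell) : Prop where
  huv : δ.u < δ.v
  hu : x₀ - 1/4 ≤ δ.u
  hv : δ.v ≤ x₀ + 1
  bot : Box Y x₀ δ.bot
  top : Box Y x₀ δ.top
  lt : ∀ x, δ.u < x → x < δ.v → f Y δ.bot x < f Y δ.top x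

lemma good_of_valid {Y x₀ : ℝ} {Q : Finset (ℝ × ℝ)} (hQ : ∀ c ∈ Q, Box Y x₀ c) {δ : Cell}
    (h : Valid Y (x₀, Y - 2) (x₀ + 1/4, Y) (x₀ - 1/4) (x₀ + 1) Q δ) : Good Y x₀ δ := by
  have hE : ∀ c ∈ ext (x₀, Y - 2) (x₀ + 1/4, Y) Q, Box Y x₀ c := by
    intro c hc
    simp only [ext, Finset.mem_insert] at hc
    rcases hc with rfl | rfl | hc
    · refine ⟨?_, ?_, ?_, ?_⟩ <;> simp only <;> linarith
    · refine ⟨?_, ?_, ?_, ?_⟩ <;> simp only <;> linarith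
    · exact hQ c hc
  exact ⟨h.huv, h.hu, h.hv, hE _ h.bot_mem, hE _ h.top_mem, h.lt⟩

/-- the partition theorem for point sets in general position -/
lemma generic : ∃ K : ℝ, 0 < K ∧ ∀ (Y x₀ : ℝ) {ι : Type} [Fintype ι] (ps : ι → ℝ × ℝ),
    (∀ i, Y < (ps i).2 ∧ (ps i).2 ≤ Y + 3/4 ∧ x₀ ≤ (ps i).1 ∧ (ps i).1 ≤ x₀ + 3/4) →
    (∀ v : ℝ × ℝ, v.2 ≤ Y → (Finset.univ.filter (fun i => S (ps i) v = 0)).card ≤ 2) →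
    ∀ s m : ℕ, 1 ≤ s → 1 ≤ m → m * s ≤ Fintype.card ι → Fintype.card ι < (m+1) * s →
    ∃ (col : ι → Fin m) (δ : Fin m → Cell), (∀ i, Good Y x₀ (δ i)) ∧
      (∀ p, InCell Y (ps p) (δ (col p))) ∧
      (∀ i, s ≤ (Finset.univ.filter (fun p => col p = i)).card ∧
        (Finset.univ.filter (fun p => col p = i)).card < 2 * s) ∧
      ∀ q : ℝ × ℝ, q.2 ≤ Y →
        ((Finset.univ.filter (fun i => Crs Y x₀ q (δ i))).card : ℝ) ≤ K * Real.sqrt m := by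
  obtain ⟨ρ₀, hρ₀, hpar⟩ := params
  refine ⟨2000 + ρ₀, by positivity, ?_⟩
  intro Y x₀ ι _ ps hps h0 s m hs hm h1 h2
  have hm' : (1:ℝ) ≤ m := by exact_mod_cast hm
  have hsm1 : 1 ≤ Real.sqrt m := Real.one_le_sqrt.2 hm'
  have hsm2 : Real.sqrt m * Real.sqrt m = m := Real.mul_self_sqrt (by linarith)
  have hne : Nonempty ι := by
    rw [← Fintype.card_pos_iff]
    have : 1 * 1 ≤ m * s := Nat.mul_le_mul hm hs
    omega
  rcases lt_or_ge (Nat.sqrt m) ρ₀ with hr | hr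
  · have hQ : ∀ c ∈ ({(x₀, Y - 2)} : Finset (ℝ × ℝ)), Box Y x₀ c := by
      intro c hc
      rw [Finset.mem_singleton] at hc
      subst hc
      refine ⟨?_, ?_, ?_, ?_⟩ <;> simp only <;> linarith
    obtain ⟨hb, htp, hpos⟩ := setup Y x₀ _ hQ
    obtain ⟨col, δ, hv, hin, hc, -⟩ := partition_lemma hb (by simp) (by linarith) htp ps
      (fun p => hpos _ (hps p).1.le (hps p).2.1 (hps p).2.2.1 (hps p).2.2.2) s hs m hm h1 h2
    refine ⟨col, δ, fun i => good_of_valid hQ (hv i), hin, hc, ?_⟩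
    intro q _
    have a1 : ((Finset.univ.filter (fun i => Crs Y x₀ q (δ i))).card : ℝ) ≤ m := by
      have := Finset.card_filter_le (Finset.univ : Finset (Fin m)) (fun i => Crs Y x₀ q (δ i))
      rw [Finset.card_univ, Fintype.card_fin] at this
      exact_mod_cast this
    have a2 : Real.sqrt m ≤ ρ₀ := by
      rw [Real.sqrt_le_left (by positivity)]
      have := Nat.sqrt_lt'.1 hr
      exact_mod_cast this.le
    nlinarith
  · obtain ⟨p1, p2, p3⟩ := hpar _ hr
    set ρ := Nat.sqrt m with hρ
    have hρ4 : (4:ℝ) ≤ ρ := by exact_mod_cast hρ₀.trans hr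
    have hρu : (ρ:ℝ) ≤ Real.sqrt m := by
      apply Real.le_sqrt_of_sq_le
      have := Nat.sqrt_le' m
      exact_mod_cast this
    have hρl : Real.sqrt m ≤ ρ + 1 := by
      rw [Real.sqrt_le_left (by positivity)]
      have := Nat.lt_succ_sqrt' m
      exact_mod_cast this.le
    obtain ⟨Q, hQne, hQc, hQb, hQ⟩ := test_set Y x₀ ps (fun i => (hps i).1) (ρ^3) p2 (1/(ρ:ℝ))
      (by positivity) (by rw [div_le_one (by linarith)]; linarith) p3
    obtain ⟨hb, htp, hpos⟩ := setup Y x₀ Q hQb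
    obtain ⟨col, δ, hv, hin, hc, hcf⟩ := partition_lemma hb hQne (by linarith) htp ps
      (fun p => hpos _ (hps p).1.le (hps p).2.1 (hps p).2.2.1 (hps p).2.2.2) s hs m hm h1 h2
    refine ⟨col, δ, fun i => good_of_valid hQb (hv i), hin, hc, ?_⟩
    intro q hqY
    rcases Finset.eq_empty_or_nonempty (Finset.univ.filter (fun i => Crs Y x₀ q (δ i))) with he | ⟨i, hi⟩
    · rw [he]; simp; positivity
    have hbox : Box Y x₀ q := (Finset.mem_filter.1 hi).2.box hqY
    obtain ⟨H, hHQ, hH4, hmix, hbr⟩ := hQ q hbox.1 hbox.2.1 hbox.2.2.1 hbox.2.2.2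
    set B : ℕ := ⌊(ρ:ℝ) + 480 * Real.sqrt m⌋₊ with hBdef
    have hBle : (B:ℝ) ≤ ρ + 480 * Real.sqrt m := Nat.floor_le (by positivity)
    obtain ⟨c, hc1, hc2⟩ := count_bound (x₀ := x₀) ps (fun i => (hps i).1) col δ (fun i => (hv i).huv)
      (fun i => (hv i).lt) hin s (fun i => (hc i).1) q H hH4 B
      (fun h hh => Nat.le_floor (hcf h (hHQ hh) ρ (hQc.trans p1)))
      (fun h hh => h0 h (hQb h (hHQ hh)).2.2.2) hbr
    have d1 : ((Finset.univ.filter (fun i => Crs Y x₀ q (δ i))).card : ℝ) ≤ 4 * B + 8 + c := by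
      exact_mod_cast hc1
    have d2 : (c:ℝ) * s ≤ 16 * (1/(ρ:ℝ) * Fintype.card ι) := by
      refine le_trans ?_ hmix
      exact_mod_cast hc2
    have s0 : (0:ℝ) < s := by exact_mod_cast hs
    have d3 : (Fintype.card ι : ℝ) ≤ (m + 1) * s := by exact_mod_cast h2.le
    have d4 : (c:ℝ) ≤ 16 * (1/(ρ:ℝ) * (m+1)) := by
      have : (c:ℝ) * s ≤ 16 * (1/(ρ:ℝ) * (m+1)) * s := by
        refine d2.trans ?_
        calc 16 * (1/(ρ:ℝ) * Fintype.card ι) ≤ 16 * (1/(ρ:ℝ) * ((m+1) * s)) := by gcongr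
          _ = _ := by ring
      exact le_of_mul_le_mul_right this s0
    have d5 : (c:ℝ) ≤ 64 * Real.sqrt m := by
      refine d4.trans ?_
      have : 1/(ρ:ℝ) * (m+1) ≤ 4 * Real.sqrt m := by
        rw [one_div, inv_mul_le_iff₀ (by linarith)]
        nlinarith
      linarith
    have : 0 ≤ (ρ₀:ℝ) * Real.sqrt m := by positivity
    nlinarith

end PT

namespace PT

lemma center_unique {Y : ℝ} {a b v w : ℝ × ℝ} (hab : a ≠ b) (ha : Y < a.2) (hb : Y < b.2)
    (hv : v.2 ≤ Y) (hw : w.2 ≤ Y) (h1 : S a v = 0) (h2 : S b v = 0) (h3 : S a w = 0)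
    (h4 : S b w = 0) : v = w := by
  rw [S_rf] at h1 h2 h3 h4
  have hne : rf a ≠ rf b := fun h => hab (by rw [← rf_rf a, h, rf_rf])
  set Y' : ℝ := max (rf a).2 (rf b).2 with hY'
  have hY'Y : Y' < -Y := by
    refine max_lt ?_ ?_ <;> simp only [rf] <;> linarith
  have v2 : (rf v).2 = -v.2 := rfl
  have w2 : (rf w).2 = -w.2 := rfl
  have v1 : (rf v).1 = v.1 := rfl
  have w1 : (rf w).1 = w.1 := rfl
  rw [v1] at h1 h2
  rw [w1] at h3 h4
  have e1 : f Y' (rf a) v.1 = -v.2 := by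
    unfold f; rw [max_eq_right] <;> linarith
  have e2 : f Y' (rf b) v.1 = -v.2 := by
    unfold f; rw [max_eq_right] <;> linarith
  have e3 : f Y' (rf a) w.1 = -w.2 := by
    unfold f; rw [max_eq_right] <;> linarith
  have e4 : f Y' (rf b) w.1 = -w.2 := by
    unfold f; rw [max_eq_right] <;> linarith
  have := cross_unique (Y := Y') (le_max_left _ _) (le_max_right _ _) hne (e1.trans e2.symm)
    (by linarith) (e3.trans e4.symm) (by linarith)
  refine Prod.ext this ?_
  rw [this] at e1
  linarith

/-- shift upwards -/
def sh (p : ℝ × ℝ) (e : ℝ) : ℝ × ℝ := (p.1, p.2 + e)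

lemma S_sh (p v : ℝ × ℝ) (e : ℝ) : S (sh p e) v = S p v + e := by
  unfold S sh; simp only; ring

lemma perturb {ι : Type*} (Y : ℝ) (ps : ι → ℝ × ℝ) (hps : ∀ i, Y ≤ (ps i).2) (η : ℝ) (hη : 0 < η)
    (J : Finset ι) : ∃ e : ι → ℝ, (∀ i, 0 < e i ∧ e i < η) ∧
      (∀ i ∈ J, ∀ j ∈ J, i ≠ j → sh (ps i) (e i) ≠ sh (ps j) (e j)) ∧
      ∀ v : ℝ × ℝ, v.2 ≤ Y → (J.filter (fun i => S (sh (ps i) (e i)) v = 0)).card ≤ 2 := by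
  induction J using Finset.induction_on with
  | empty => exact ⟨fun _ => η/2, fun _ => ⟨by linarith, by linarith⟩, by simp, by simp⟩
  | insert k J hk ih =>
    obtain ⟨e, he, hd, hc⟩ := ih
    have hY : ∀ i, Y < (sh (ps i) (e i)).2 := fun i => by
      have := hps i; have := (he i).1; simp only [sh]; linarith
    set B1 : Set ℝ := ⋃ i ∈ J, {x | sh (ps k) x = sh (ps i) (e i)} with hB1
    set B2 : Set ℝ := ⋃ i ∈ J, ⋃ j ∈ J, {x | i ≠ j ∧ ∃ v : ℝ × ℝ, v.2 ≤ Y ∧ S (sh (ps i) (e i)) v = 0 ∧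
      S (sh (ps j) (e j)) v = 0 ∧ S (sh (ps k) x) v = 0} with hB2
    have f1 : B1.Finite := by
      refine J.finite_toSet.biUnion fun i _ => Set.Subsingleton.finite ?_
      intro x hx y hy
      have := hx.trans hy.symm
      simp only [sh, Prod.mk.injEq, true_and] at this
      linarith
    have f2 : B2.Finite := by
      refine J.finite_toSet.biUnion fun i hi => J.finite_toSet.biUnion fun j hj =>
        Set.Subsingleton.finite ?_
      rintro x ⟨hij, v, hv, v1, v2, v3⟩ y ⟨-, w, hw, w1, w2, w3⟩
      have := center_unique (hd i hi j hj hij) (hY i) (hY j) hv hw v1 v2 w1 w2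
      subst this
      rw [S_sh] at v3 w3
      linarith
    obtain ⟨x, hx, hxB⟩ := (Set.Ioo_infinite hη).exists_notMem_finite (f1.union f2)
    rw [Set.mem_union, not_or] at hxB
    obtain ⟨x1, x2⟩ := hxB
    have hup : ∀ i ∈ J, Function.update e k x i = e i := fun i hi =>
      Function.update_of_ne (by rintro rfl; exact hk hi) _ _
    refine ⟨Function.update e k x, ?_, ?_, ?_⟩
    · intro i
      rcases eq_or_ne i k with rfl | h
      · rw [Function.update_self]; exact hx
      · rw [Function.update_of_ne h]; exact he i
    · have key : ∀ i ∈ J, sh (ps k) x ≠ sh (ps i) (e i) := by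
        intro i hi h
        exact x1 (Set.mem_biUnion hi h)
      intro i hi j hj hij
      rcases Finset.mem_insert.1 hi with rfl | hi' <;> rcases Finset.mem_insert.1 hj with rfl | hj'
      · exact absurd rfl hij
      · rw [Function.update_self, hup j hj']; exact key j hj'
      · rw [Function.update_self, hup i hi']; exact (key i hi').symm
      · rw [hup i hi', hup j hj']; exact hd i hi' j hj' hij
    · intro v hv
      have hfe : J.filter (fun i => S (sh (ps i) (Function.update e k x i)) v = 0) =
          J.filter (fun i => S (sh (ps i) (e i)) v = 0) :=
        Finset.filter_congr fun i hi => by rw [hup i hi]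
      rw [Finset.filter_insert, hfe]
      split_ifs with h
      · rw [Function.update_self] at h
        refine (Finset.card_insert_le _ _).trans ?_
        have : (J.filter (fun i => S (sh (ps i) (e i)) v = 0)).card ≤ 1 := by
          rw [Finset.card_le_one]
          intro i hi j hj
          by_contra hij
          rw [Finset.mem_filter] at hi hj
          exact x2 (Set.mem_biUnion hi.1 (Set.mem_biUnion hj.1 ⟨hij, v, hv, hi.2, hj.2, h⟩))
        omega
      · exact hc v hv

lemma ulim (a : ℕ → ℝ) (A B : ℝ) (h : ∀ k, A ≤ a k ∧ a k ≤ B) :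
    ∃ L, A ≤ L ∧ L ≤ B ∧ Filter.Tendsto a (Filter.hyperfilter ℕ : Filter ℕ) (nhds L) := by
  obtain ⟨L, hL, hle⟩ := (isCompact_Icc (a := A) (b := B)).ultrafilter_le_nhds
    ((Filter.hyperfilter ℕ).map a) (by
      rw [Filter.le_principal_iff]
      exact Filter.Eventually.of_forall (f := (Filter.hyperfilter ℕ : Filter ℕ)) (fun k => h k))
  exact ⟨L, hL.1, hL.2, hle⟩

lemma Good.g_le {Y x₀ : ℝ} {δ : Cell} (h : Good Y x₀ δ) :
    ∀ x ∈ Set.Icc δ.u δ.v, g δ.bot x ≤ g δ.top x := by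
  refine le_Icc_of_Ioo (g_cont _) (g_cont _) h.huv fun x h1 h2 => ?_
  have h3 := h.lt x h1 h2
  have h4 := f_eq_g ((f_ge Y δ.bot x).trans_lt h3)
  have := g_le_f Y δ.bot x
  linarith

lemma general : ∃ K : ℝ, 0 < K ∧ ∀ (Y x₀ : ℝ) (n : ℕ) (ps : Fin n → ℝ × ℝ),
    (∀ i, Y ≤ (ps i).2 ∧ (ps i).2 ≤ Y + 72/100 ∧ x₀ ≤ (ps i).1 ∧ (ps i).1 ≤ x₀ + 3/4) →
    ∀ s m : ℕ, 1 ≤ s → 1 ≤ m → m * s ≤ n → n < (m+1) * s →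
    ∃ (col : Fin n → Fin m) (δ : Fin m → Cell),
      (∀ i, (δ i).u ≤ (δ i).v ∧ (δ i).bot.2 ≤ Y ∧ (δ i).top.2 ≤ Y ∧
        ∀ x ∈ Set.Icc (δ i).u (δ i).v, g (δ i).bot x ≤ g (δ i).top x) ∧
      (∀ p, (δ (col p)).u ≤ (ps p).1 ∧ (ps p).1 ≤ (δ (col p)).v ∧
        g (δ (col p)).bot (ps p).1 ≤ (ps p).2 ∧ (ps p).2 ≤ g (δ (col p)).top (ps p).1) ∧
      (∀ i, s ≤ (Finset.univ.filter (fun p => col p = i)).card ∧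
        (Finset.univ.filter (fun p => col p = i)).card < 2 * s) ∧
      ∀ q : ℝ × ℝ, q.2 ≤ Y →
        ((Finset.univ.filter (fun i => Crs Y x₀ q (δ i))).card : ℝ) ≤ K * Real.sqrt m := by
  obtain ⟨K, hK, hgen⟩ := generic
  refine ⟨K, hK, ?_⟩
  intro Y x₀ n ps hps s m hs hm h1 h2
  have hη : ∀ k : ℕ, 0 < (3/100:ℝ) / (k + 1) := fun k => by positivity
  choose e he _ hc using fun k : ℕ => perturb Y ps (fun i => (hps i).1) _ (hη k) Finset.univ
  have hη' : ∀ k : ℕ, (3/100:ℝ) / (k + 1) ≤ 3/100 := fun k => by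
    rw [div_le_iff₀ (by positivity)]
    have : (0:ℝ) ≤ k := by positivity
    linarith
  have hgY : ∀ k i, Y < (sh (ps i) (e k i)).2 := fun k i => by
    have := (he k i).1; have := (hps i).1; simp only [sh]; linarith
  choose col δ hgood hin hsz hcr using fun k : ℕ => hgen Y x₀ (fun i => sh (ps i) (e k i))
    (fun i => ⟨hgY k i, by
      have := (he k i).2; have := hη' k; have := (hps i).2.1; simp only [sh]; linarith,
      (hps i).2.2.1, (hps i).2.2.2⟩) (hc k) s m hs hm
    (by rw [Fintype.card_fin]; exact h1) (by rw [Fintype.card_fin]; exact h2)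
  set U : Filter ℕ := (Filter.hyperfilter ℕ : Filter ℕ) with hU
  have hte : ∀ i, Filter.Tendsto (fun k => e k i) U (nhds 0) := by
    intro i
    have t1 : Filter.Tendsto (fun k : ℕ => (3/100:ℝ) / (k + 1)) U (nhds 0) :=
      (by
        have := (tendsto_one_div_add_atTop_nhds_zero_nat (𝕜 := ℝ)).const_mul (3/100:ℝ)
        simpa [div_eq_mul_inv] using this :
        Filter.Tendsto (fun k : ℕ => (3/100:ℝ) / (k + 1)) Filter.atTop (nhds 0)).mono_left Nat.hyperfilter_le_atTop
    exact tendsto_of_tendsto_of_tendsto_of_le_of_le tendsto_const_nhds t1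
      (fun k => (he k i).1.le) (fun k => (he k i).2.le)
  obtain ⟨c, hcc⟩ := Ultrafilter.eq_pure_of_finite ((Filter.hyperfilter ℕ).map col)
  have hcol : ∀ᶠ k in U, col k = c := by
    have : ({c} : Set _) ∈ (Filter.hyperfilter ℕ).map col := by rw [hcc]; exact rfl
    exact this
  choose u hu1 hu2 hut using fun i => ulim (fun k => (δ k i).u) (x₀ - 1/4) (x₀ + 1)
    (fun k => ⟨(hgood k i).hu, (hgood k i).huv.le.trans (hgood k i).hv⟩)
  choose v hv1 hv2 hvt using fun i => ulim (fun k => (δ k i).v) (x₀ - 1/4) (x₀ + 1)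
    (fun k => ⟨(hgood k i).hu.trans (hgood k i).huv.le, (hgood k i).hv⟩)
  choose b1 _ _ hb1 using fun i => ulim (fun k => (δ k i).bot.1) _ _
    (fun k => ⟨(hgood k i).bot.1, (hgood k i).bot.2.1⟩)
  choose b2 _ hb2Y hb2 using fun i => ulim (fun k => (δ k i).bot.2) _ _
    (fun k => ⟨(hgood k i).bot.2.2.1, (hgood k i).bot.2.2.2⟩)
  choose t1 _ _ ht1 using fun i => ulim (fun k => (δ k i).top.1) _ _
    (fun k => ⟨(hgood k i).top.1, (hgood k i).top.2.1⟩)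
  choose t2 _ ht2Y ht2 using fun i => ulim (fun k => (δ k i).top.2) _ _
    (fun k => ⟨(hgood k i).top.2.2.1, (hgood k i).top.2.2.2⟩)
  have hbt : ∀ i, Filter.Tendsto (fun k => (δ k i).bot) U (nhds (b1 i, b2 i)) := fun i =>
    (hb1 i).prodMk_nhds (hb2 i)
  have htt : ∀ i, Filter.Tendsto (fun k => (δ k i).top) U (nhds (t1 i, t2 i)) := fun i =>
    (ht1 i).prodMk_nhds (ht2 i)
  have hg : ∀ (a : ℕ → ℝ × ℝ) (a' : ℝ × ℝ) (x : ℕ → ℝ) (x' : ℝ), Filter.Tendsto a U (nhds a') →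
      Filter.Tendsto x U (nhds x') → Filter.Tendsto (fun k => g (a k) (x k)) U (nhds (g a' x')) := by
    intro a a' x x' h h'
    exact (g_cont2.tendsto (a', x')).comp (h.prodMk_nhds h')
  have huv : ∀ i, u i ≤ v i := fun i =>
    le_of_tendsto_of_tendsto' (hut i) (hvt i) fun k => (hgood k i).huv.le
  refine ⟨c, fun i => ⟨(b1 i, b2 i), (t1 i, t2 i), u i, v i⟩, ?_, ?_, ?_, ?_⟩
  · intro i
    refine ⟨huv i, hb2Y i, ht2Y i, ?_⟩
    intro x hx
    have hxt : Filter.Tendsto (fun k => max (δ k i).u (min x (δ k i).v)) U (nhds x) := by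
      have := (hut i).max ((tendsto_const_nhds (x := x)).min (hvt i))
      rwa [min_eq_left hx.2, max_eq_right hx.1] at this
    refine le_of_tendsto_of_tendsto' (hg _ _ _ _ (hbt i) hxt) (hg _ _ _ _ (htt i) hxt) fun k => ?_
    exact (hgood k i).g_le _ ⟨le_max_left _ _, max_le (hgood k i).huv.le (min_le_right _ _)⟩
  · intro p
    have hp2 : Filter.Tendsto (fun k => (ps p).2 + e k p) U (nhds (ps p).2) := by
      have := (tendsto_const_nhds (x := (ps p).2)).add (hte p)
      rwa [add_zero] at this
    have hinc : ∀ᶠ k in U, InCell Y (sh (ps p) (e k p)) (δ k (c p)) := by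
      filter_upwards [hcol] with k hk
      rw [← hk]; exact hin k p
    refine ⟨?_, ?_, ?_, ?_⟩
    · exact le_of_tendsto (hut _) (hinc.mono fun k hk => hk.1)
    · exact ge_of_tendsto (hvt _) (hinc.mono fun k hk => hk.2.1)
    · refine le_of_tendsto_of_tendsto (hg _ _ _ _ (hbt (c p)) tendsto_const_nhds) hp2
        (hinc.mono fun k hk => ?_)
      exact (g_le_f Y _ _).trans hk.2.2.1
    · refine le_of_tendsto_of_tendsto hp2 (hg _ _ _ _ (htt (c p)) tendsto_const_nhds)
        (hinc.mono fun k hk => ?_)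
      have a := hk.2.2.2
      rw [f_eq_g ((hgY k p).trans_le a)] at a
      exact a
  · intro i
    obtain ⟨k, hk⟩ := hcol.exists
    rw [← hk]; exact hsz k i
  · intro q hq
    have hev : ∀ i, Crs Y x₀ q ⟨(b1 i, b2 i), (t1 i, t2 i), u i, v i⟩ →
        ∀ᶠ k in U, Crs Y x₀ q (δ k i) := by
      rintro i ⟨z, z1, z2, z3, z4, z5, z6⟩
      simp only at z1 z2 z3 z5
      filter_upwards [(hut i).eventually_lt_const z1, (hvt i).eventually_const_lt z2,
        (hg _ _ _ _ (hbt i) tendsto_const_nhds).eventually_lt_const z3,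
        (hg _ _ _ _ (htt i) tendsto_const_nhds).eventually_const_lt z5] with k k1 k2 k3 k4
      exact ⟨z, k1, k2, k3, z4, k4, z6⟩
    have hall : ∀ᶠ k in U, ∀ i, Crs Y x₀ q ⟨(b1 i, b2 i), (t1 i, t2 i), u i, v i⟩ →
        Crs Y x₀ q (δ k i) := by
      rw [Filter.eventually_all]
      intro i
      by_cases h : Crs Y x₀ q ⟨(b1 i, b2 i), (t1 i, t2 i), u i, v i⟩
      · exact (hev i h).mono fun k hk _ => hk
      · exact Filter.Eventually.of_forall fun k hk => absurd hk h
    obtain ⟨k, hk⟩ := hall.exists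
    refine le_trans ?_ (hcr k q hq)
    have : (Finset.univ.filter (fun i => Crs Y x₀ q ⟨(b1 i, b2 i), (t1 i, t2 i), u i, v i⟩)).card ≤
        (Finset.univ.filter (fun i => Crs Y x₀ q (δ k i))).card :=
      Finset.card_le_card (Finset.monotone_filter_right _ fun i _ hi => hk i hi)
    exact_mod_cast this

end PT

namespace PT

lemma gs_sq : gs ^ 2 = 1/2 := by
  unfold gs; rw [div_pow, Real.sq_sqrt (by norm_num)]; norm_num

lemma gs_pos : 0 < gs := by unfold gs; positivity

lemma gs_le : gs ≤ 708/1000 := by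
  have := gs_sq; have := gs_pos; nlinarith

lemma square_sub {x₀ y₀ : ℝ} {z : Plane} (h : z ∈ Square x₀ y₀) : z ∈ ExtCell x₀ y₀ := by
  obtain ⟨h1, h2, h3, h4⟩ := h
  refine ⟨h1, h2, h3, ?_⟩
  have : Real.sqrt (7/8) ≤ Real.sqrt (1 - (z 0 - x₀ - gs/2)^2) := by
    apply Real.sqrt_le_sqrt
    have := gs_sq
    nlinarith
  linarith

lemma ext_height {x₀ y₀ : ℝ} {z : Plane} (h : z ∈ ExtCell x₀ y₀) : z 1 ≤ y₀ + 78/100 := by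
  obtain ⟨h1, h2, h3, h4⟩ := h
  have a : Real.sqrt (1 - (z 0 - x₀ - gs/2)^2) ≤ 1 := by
    rw [Real.sqrt_le_one]; nlinarith [sq_nonneg (z 0 - x₀ - gs/2)]
  have b : (93/100:ℝ) ≤ Real.sqrt (7/8) := by
    apply Real.le_sqrt_of_sq_le; norm_num
  have := gs_le
  linarith

lemma interior_dir {σ : Set Plane} {z : Plane} (hz : z ∈ interior σ) (w : Plane) :
    ∃ t : ℝ, 0 < t ∧ z + t • w ∈ σ := by
  have hc : Continuous (fun t : ℝ => z + t • w) := by fun_prop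
  have h1 : ∀ᶠ t in nhds (0:ℝ), z + t • w ∈ σ := by
    have := hc.tendsto 0
    rw [zero_smul, add_zero] at this
    exact this (mem_interior_iff_mem_nhds.1 hz)
  obtain ⟨ε, hε, h2⟩ := Metric.eventually_nhds_iff.1 h1
  refine ⟨ε/2, by positivity, h2 ?_⟩
  rw [Real.dist_eq, sub_zero, abs_of_pos (by positivity)]
  linarith

/-- the pseudo-trapezoid of a cell -/
def ptrap (x₀ y₀ : ℝ) (δ : Cell) : Set Plane :=
  {z ∈ ExtCell x₀ y₀ | δ.u ≤ z 0 ∧ z 0 ≤ δ.v ∧ g δ.bot (z 0) ≤ z 1 ∧ z 1 ≤ g δ.top (z 0)}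

lemma crs_of_crosses {x₀ y₀ : ℝ} {δ : Cell} {q : Plane} (hq : q 1 ≤ y₀)
    (h : Crosses q (ptrap x₀ y₀ δ)) : Crs y₀ x₀ (q 0, q 1) δ := by
  obtain ⟨z, hzq, hz⟩ := h
  have hzσ := interior_subset hz
  obtain ⟨t1, p1, -, m1, -⟩ := interior_dir hz !₂[(-1:ℝ), 0]
  obtain ⟨t2, p2, -, -, m2, -⟩ := interior_dir hz !₂[(1:ℝ), 0]
  obtain ⟨t3, p3, ⟨-, -, m3', -⟩, -, -, m3, -⟩ := interior_dir hz !₂[(0:ℝ), -1]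
  obtain ⟨t4, p4, -, -, -, -, m4⟩ := interior_dir hz !₂[(0:ℝ), 1]
  simp at m1 m2 m3' m3 m4
  have hY : y₀ < z 1 := by linarith
  refine ⟨(z 0, z 1), ?_, ?_, ?_, hY, ?_, ext_height hzσ.1, hzσ.1.1, ?_, ?_⟩ <;> simp only
  · linarith
  · linarith
  · linarith
  · linarith
  · have := hzσ.1.2.1; have := gs_le; linarith
  · have h1 : dist z q = 1 := hzq
    rw [EuclideanSpace.dist_eq, Real.sqrt_eq_one, Fin.sum_univ_two, Real.dist_eq, Real.dist_eq,
      sq_abs, sq_abs] at h1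
    unfold S
    simp only
    rw [show 1 - (z 0 - q 0)^2 = (z 1 - q 1)^2 by linarith, Real.sqrt_sq (by linarith)]
    ring

end PT

/-- **Partition Theorem.** There is a constant `K` such that for every
configuration of squares `C` (below `y = y₀`) and `C'`, every finite set `P`
of `n` points in `C'` and every integer `2 ≤ s' < n`, there exist a partition
of `P` into parts `P₁, …, P_m` and pseudo-trapezoids `σ₁, …, σ_m` with
`Pᵢ ⊆ σᵢ` and `s' ≤ |Pᵢ| < 2s'`, such that every unit circle centered in `C`
crosses at most `K·√(n/s')` of the pseudo-trapezoids. -/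
theorem partition_theorem :
    ∃ K : ℝ, 0 < K ∧
      ∀ x₀ y₀ x₁ y₁ : ℝ, y₁ + gs ≤ y₀ →
      ∀ P : Finset Plane, (∀ p ∈ P, p ∈ Square x₀ y₀) →
      ∀ s' : ℕ, 2 ≤ s' → s' < P.card →
      ∃ (m : ℕ) (Ps : Fin m → Finset Plane) (σs : Fin m → Set Plane),
        (∀ i, IsPseudoTrapezoid x₀ y₀ (σs i)) ∧
        (∀ i, ∀ p ∈ Ps i, p ∈ σs i) ∧
        (∀ i, Ps i ⊆ P) ∧
        (∀ p ∈ P, ∃ i, p ∈ Ps i) ∧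
        (∀ i j, i ≠ j → Disjoint (Ps i) (Ps j)) ∧
        (∀ i, s' ≤ (Ps i).card ∧ (Ps i).card < 2 * s') ∧
        (∀ q ∈ Square x₁ y₁,
          ({i : Fin m | Crosses q (σs i)}.ncard : ℝ) ≤
            K * Real.sqrt ((P.card : ℝ) / (s' : ℝ))) := by
  obtain ⟨K, hK, hgen⟩ := PT.general
  refine ⟨K, hK, ?_⟩
  intro x₀ y₀ x₁ y₁ hy P hP s' hs' hsn
  have hgs := PT.gs_le
  set n := P.card with hn
  set m := n / s' with hm
  have hs0 : 0 < s' := by omega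
  have hm1 : 1 ≤ m := (Nat.one_le_div_iff hs0).2 hsn.le
  set e := P.equivFin with he
  set pt : Fin n → Plane := fun i => (e.symm i : Plane) with hpt
  have hinj : Function.Injective pt := Subtype.val_injective.comp e.symm.injective
  have hmem : ∀ i, pt i ∈ P := fun i => (e.symm i).2
  obtain ⟨col, δ, hd, hin, hsz, hcr⟩ := hgen y₀ x₀ n (fun i => (pt i 0, pt i 1)) (by
    intro i
    obtain ⟨h1, h2, h3, h4⟩ := hP _ (hmem i)
    refine ⟨h3, ?_, h1, ?_⟩ <;> simp only <;> linarith) s' m (by omega) hm1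
    (Nat.div_mul_le_self n s') (by
      have := Nat.lt_div_mul_add hs0 (a := n)
      rw [add_mul, one_mul]; exact this)
  have hcard : ∀ i, ((Finset.univ.filter (fun p => col p = i)).image pt).card =
      (Finset.univ.filter (fun p => col p = i)).card := fun i =>
    Finset.card_image_of_injective _ hinj
  refine ⟨m, fun i => (Finset.univ.filter (fun p => col p = i)).image pt,
    fun i => PT.ptrap x₀ y₀ (δ i), ?_, ?_, ?_, ?_, ?_, ?_, ?_⟩
  · intro i
    obtain ⟨h1, h2, h3, h4⟩ := hd i
    refine ⟨(δ i).u, (δ i).v, PT.g (δ i).bot, PT.g (δ i).top, h1,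
      ⟨!₂[(δ i).top.1, (δ i).top.2], by simpa using h3, fun x => by simp [PT.g]⟩,
      Or.inr ⟨!₂[(δ i).bot.1, (δ i).bot.2], by simpa using h2, fun x => by simp [PT.g]⟩,
      fun x hx hx' => h4 x ⟨hx, hx'⟩, rfl⟩
  · intro i p hp
    obtain ⟨k, hk, rfl⟩ := Finset.mem_image.1 hp
    have hk' : col k = i := (Finset.mem_filter.1 hk).2
    subst hk'
    exact ⟨PT.square_sub (hP _ (hmem k)), hin k⟩
  · intro i p hp
    obtain ⟨k, hk, rfl⟩ := Finset.mem_image.1 hp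
    exact hmem k
  · intro p hp
    refine ⟨col (e ⟨p, hp⟩), Finset.mem_image.2 ⟨e ⟨p, hp⟩, by simp, ?_⟩⟩
    simp [hpt]
  · intro i j hij
    rw [Finset.disjoint_left]
    intro p hp hp'
    obtain ⟨k, hk, rfl⟩ := Finset.mem_image.1 hp
    obtain ⟨l, hl, hkl⟩ := Finset.mem_image.1 hp'
    have := hinj hkl
    subst this
    exact hij ((Finset.mem_filter.1 hk).2.symm.trans (Finset.mem_filter.1 hl).2)
  · intro i
    rw [hcard]; exact hsz i
  · intro q hq
    have hqY : q 1 ≤ y₀ := by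
      have := hq.2.2.2; linarith
    have h1 : {i : Fin m | Crosses q (PT.ptrap x₀ y₀ (δ i))}.ncard ≤
        (Finset.univ.filter (fun i => PT.Crs y₀ x₀ (q 0, q 1) (δ i))).card := by
      rw [← Set.ncard_coe_finset]
      refine Set.ncard_le_ncard ?_ (Finset.finite_toSet _)
      intro i hi
      simp only [Finset.coe_filter, Finset.mem_univ, true_and]
      exact PT.crs_of_crosses hqY hi
    calc (({i : Fin m | Crosses q (PT.ptrap x₀ y₀ (δ i))}.ncard : ℕ) : ℝ)
        ≤ ((Finset.univ.filter (fun i => PT.Crs y₀ x₀ (q 0, q 1) (δ i))).card : ℝ) := by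
          exact_mod_cast h1
      _ ≤ K * Real.sqrt m := hcr (q 0, q 1) hqY
      _ ≤ K * Real.sqrt ((n:ℝ) / s') := by
          gcongr
          exact Nat.cast_div_le
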